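/- arXiv:2511.23234 — 2 statements merged into one kernel-verified Lean document; each statement's English description precedes it below -/
import Mathlib

section
/- Pointwise evolution inequality for the weighted gradient quantity ω (flat-background case of inequality (3.6) in the proof of Theorem 4.1 of the paper): There exist ε₀(n) > 0 and L = L(n) ≥ 1 such that for every open set U ⊆ ℝⁿ, every open time interval I, and every Ricci–DeTurck flow g on U over I with |g(t,x) − δ| ≤ ε₀(n) for all (t,x) ∈ I × U, the function ω := (1 + L |g − δ|²) |∂g|² satisfies at every point (t,x) ∈ I × U: ∂_t ω ≤ ∑_{a,b} g^{ab} ∂_a ∂_b ω − |∂²g|² − (L/2) |∂g|⁴. -/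
open MeasureTheory Metric Set Filter Topology

noncomputable section

/-- Euclidean space `ℝⁿ`. -/
abbrev Eucl (n : ℕ) : Type := EuclideanSpace ℝ (Fin n)

/-- The partial derivative `∂_a f` of a scalar function in the `a`-th coordinate direction. -/
noncomputable def pd {n : ℕ} (a : Fin n) (f : Eucl n → ℝ) (x : Eucl n) : ℝ :=
  fderiv ℝ f x (EuclideanSpace.single a 1)

/-- Squared Frobenius distance between two `n × n` matrices. -/
def matDistSq {n : ℕ} (A B : Matrix (Fin n) (Fin n) ℝ) : ℝ :=
  ∑ i, ∑ j, (A i j - B i j) ^ 2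

/-- `|∂g|²` for a time-dependent matrix field (flat background). -/
noncomputable def gradSq {n : ℕ} (g : ℝ → Eucl n → Matrix (Fin n) (Fin n) ℝ)
    (t : ℝ) (x : Eucl n) : ℝ :=
  ∑ a, ∑ i, ∑ j, (pd a (fun y => g t y i j) x) ^ 2

/-- `|∂²g|²` for a time-dependent matrix field (flat background). -/
noncomputable def hessSq {n : ℕ} (g : ℝ → Eucl n → Matrix (Fin n) (Fin n) ℝ)
    (t : ℝ) (x : Eucl n) : ℝ :=
  ∑ a, ∑ b, ∑ i, ∑ j, (pd a (fun y => pd b (fun z => g t z i j) y) x) ^ 2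

/-- `|∂k|²` for a static matrix field. -/
noncomputable def gradSqS {n : ℕ} (k : Eucl n → Matrix (Fin n) (Fin n) ℝ) (x : Eucl n) : ℝ :=
  ∑ a, ∑ i, ∑ j, (pd a (fun y => k y i j) x) ^ 2

/-- `|∂²k|²` for a static matrix field. -/
noncomputable def hessSqS {n : ℕ} (k : Eucl n → Matrix (Fin n) (Fin n) ℝ) (x : Eucl n) : ℝ :=
  ∑ a, ∑ b, ∑ i, ∑ j, (pd a (fun y => pd b (fun z => k z i j) y) x) ^ 2

/-- A Ricci–DeTurck flow with flat Euclidean background metric on the spatial set `U`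
over the time set `I`: a jointly smooth family of symmetric positive-definite matrix
fields satisfying the flat-background Ricci–DeTurck equation. -/
def IsRicciDeTurckFlow {n : ℕ} (g : ℝ → Eucl n → Matrix (Fin n) (Fin n) ℝ)
    (I : Set ℝ) (U : Set (Eucl n)) : Prop :=
  (∀ i j : Fin n, ContDiffOn ℝ (⊤ : ℕ∞) (fun p : ℝ × Eucl n => g p.1 p.2 i j) (I ×ˢ U)) ∧
  (∀ t ∈ I, ∀ x ∈ U, (g t x).IsSymm ∧ (g t x).PosDef) ∧
  (∀ t ∈ I, ∀ x ∈ U, ∀ i j : Fin n,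
    deriv (fun s => g s x i j) t =
      (∑ a, ∑ b, (g t x)⁻¹ a b * pd a (fun y => pd b (fun z => g t z i j) y) x)
      + (1/2) * ∑ a, ∑ b, ∑ p, ∑ q, (g t x)⁻¹ a b * (g t x)⁻¹ p q *
        ( pd i (fun y => g t y p a) x * pd j (fun y => g t y q b) x
          + 2 * pd a (fun y => g t y j p) x * pd q (fun y => g t y i b) x
          - 2 * pd a (fun y => g t y j p) x * pd b (fun y => g t y i q) x
          - 2 * pd j (fun y => g t y p a) x * pd b (fun y => g t y i q) x
          - 2 * pd i (fun y => g t y p a) x * pd b (fun y => g t y j q) x ))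

open scoped ContDiff

namespace RicciDeTurck

section Calculus

variable {W : Type*} [NormedAddCommGroup W] [NormedSpace ℝ W] {Ω : Set W}

/-- Directional derivative of a scalar function. -/
def dirD (v : W) (F : W → ℝ) (p : W) : ℝ := fderiv ℝ F p v

lemma dirD_congr (hΩ : IsOpen Ω) {F H : W → ℝ} (h : EqOn F H Ω) (v : W) :
    EqOn (dirD v F) (dirD v H) Ω := fun p hp => by
  have : F =ᶠ[𝓝 p] H := h.eventuallyEq_of_mem (hΩ.mem_nhds hp)
  simp [dirD, this.fderiv_eq]

lemma differentiableAt_of_smooth (hΩ : IsOpen Ω) {F : W → ℝ} (hF : ContDiffOn ℝ ∞ F Ω) {p : W}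
    (hp : p ∈ Ω) : DifferentiableAt ℝ F p :=
  (hF.contDiffAt (hΩ.mem_nhds hp)).differentiableAt (by simp)

lemma smooth_dirD (hΩ : IsOpen Ω) {F : W → ℝ} (hF : ContDiffOn ℝ ∞ F Ω) (v : W) :
    ContDiffOn ℝ ∞ (dirD v F) Ω :=
  (hF.fderiv_of_isOpen hΩ (by simp)).clm_apply contDiffOn_const

lemma dirD_comm (hΩ : IsOpen Ω) {F : W → ℝ} (hF : ContDiffOn ℝ ∞ F Ω) (v w : W) :
    EqOn (dirD v (dirD w F)) (dirD w (dirD v F)) Ω := fun p hp => by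
  have hc := hF.contDiffAt (hΩ.mem_nhds hp)
  have hs : IsSymmSndFDerivAt ℝ F p :=
    hc.isSymmSndFDerivAt (by simp; exact WithTop.coe_le_coe.2 le_top)
  have hd : DifferentiableAt ℝ (fderiv ℝ F) p :=
    (hc.fderiv_right (m := 1) (by norm_cast)).differentiableAt (by simp)
  have key : ∀ a b : W, dirD a (dirD b F) p = fderiv ℝ (fderiv ℝ F) p a b := fun a b => by
    change fderiv ℝ (fun q => fderiv ℝ F q b) p a = _
    rw [fderiv_clm_apply hd (differentiableAt_const b)]
    simp
  rw [key, key]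
  exact hs v w

lemma dirD_mul {F H : W → ℝ} {p : W} (hF : DifferentiableAt ℝ F p)
    (hH : DifferentiableAt ℝ H p) (v : W) :
    dirD v (fun q => F q * H q) p = F p * dirD v H p + dirD v F p * H p := by
  simp only [dirD]
  rw [fderiv_fun_mul hF hH]
  simp; ring

lemma dirD_add {F H : W → ℝ} {p : W} (hF : DifferentiableAt ℝ F p)
    (hH : DifferentiableAt ℝ H p) (v : W) :
    dirD v (fun q => F q + H q) p = dirD v F p + dirD v H p := by
  simp only [dirD]
  rw [fderiv_fun_add hF hH]
  simp

lemma dirD_sub {F H : W → ℝ} {p : W} (hF : DifferentiableAt ℝ F p)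
    (hH : DifferentiableAt ℝ H p) (v : W) :
    dirD v (fun q => F q - H q) p = dirD v F p - dirD v H p := by
  simp only [dirD]
  rw [fderiv_fun_sub hF hH]
  simp

lemma dirD_sum {ι : Type*} (s : Finset ι) {F : ι → W → ℝ} {p : W}
    (hF : ∀ i ∈ s, DifferentiableAt ℝ (F i) p) (v : W) :
    dirD v (fun q => ∑ i ∈ s, F i q) p = ∑ i ∈ s, dirD v (F i) p := by
  simp only [dirD]
  rw [fderiv_fun_sum hF]
  simp

lemma dirD_const (c : ℝ) (v p : W) : dirD v (fun _ => c) p = 0 := by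
  simp [dirD]

lemma dirD_const_add_mul {F : W → ℝ} {p : W} (hF : DifferentiableAt ℝ F p) (c L : ℝ) (v : W) :
    dirD v (fun q => c + L * F q) p = L * dirD v F p := by
  rw [dirD_add (by fun_prop) (by fun_prop), dirD_mul (by fun_prop) hF]
  simp [dirD_const]

lemma dirD_dirD_mul (hΩ : IsOpen Ω) {F H : W → ℝ} (hF : ContDiffOn ℝ ∞ F Ω)
    (hH : ContDiffOn ℝ ∞ H Ω) (v w : W) {p : W} (hp : p ∈ Ω) :
    dirD v (dirD w (fun q => F q * H q)) p =
      F p * dirD v (dirD w H) p + dirD v F p * dirD w H p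
        + dirD w F p * dirD v H p + dirD v (dirD w F) p * H p := by
  have h1 : EqOn (dirD w (fun q => F q * H q)) (fun q => F q * dirD w H q + dirD w F q * H q) Ω :=
    fun q hq => dirD_mul (differentiableAt_of_smooth hΩ hF hq)
      (differentiableAt_of_smooth hΩ hH hq) w
  have hF' := differentiableAt_of_smooth hΩ hF hp
  have hH' := differentiableAt_of_smooth hΩ hH hp
  have hFw := differentiableAt_of_smooth hΩ (smooth_dirD hΩ hF w) hp
  have hHw := differentiableAt_of_smooth hΩ (smooth_dirD hΩ hH w) hp
  rw [dirD_congr hΩ h1 v hp, dirD_add (hF'.fun_mul hHw) (hFw.fun_mul hH'), dirD_mul hF' hHw,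
    dirD_mul hFw hH']
  ring

lemma dirD_dirD_sum (hΩ : IsOpen Ω) {ι : Type*} (s : Finset ι) {F : ι → W → ℝ}
    (hF : ∀ i ∈ s, ContDiffOn ℝ ∞ (F i) Ω) (v w : W) {p : W} (hp : p ∈ Ω) :
    dirD v (dirD w (fun q => ∑ i ∈ s, F i q)) p = ∑ i ∈ s, dirD v (dirD w (F i)) p := by
  have h1 : EqOn (dirD w (fun q => ∑ i ∈ s, F i q)) (fun q => ∑ i ∈ s, dirD w (F i) q) Ω :=
    fun q hq => dirD_sum s (fun i hi => differentiableAt_of_smooth hΩ (hF i hi) hq) w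
  rw [dirD_congr hΩ h1 v hp]
  exact dirD_sum s (fun i hi => differentiableAt_of_smooth hΩ (smooth_dirD hΩ (hF i hi) w) hp) v

lemma dirD_dirD_const_add_mul (hΩ : IsOpen Ω) {F : W → ℝ} (hF : ContDiffOn ℝ ∞ F Ω) (c L : ℝ)
    (v w : W) {p : W} (hp : p ∈ Ω) :
    dirD v (dirD w (fun q => c + L * F q)) p = L * dirD v (dirD w F) p := by
  have h1 : EqOn (dirD w (fun q => c + L * F q)) (fun q => 0 + L * dirD w F q) Ω :=
    fun q hq => by
      simpa using dirD_const_add_mul (differentiableAt_of_smooth hΩ hF hq) c L w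
  rw [dirD_congr hΩ h1 v hp]
  exact dirD_const_add_mul (differentiableAt_of_smooth hΩ (smooth_dirD hΩ hF w) hp) 0 L v

/-- The parabolic operator `∂_τ - ∑ G^{ab} ∂_a ∂_b` in the directions `τ` and `e a`. -/
def heatOp {ι : Type*} [Fintype ι] (τ : W) (e : ι → W) (G : ι → ι → W → ℝ) (F : W → ℝ)
    (p : W) : ℝ :=
  dirD τ F p - ∑ a, ∑ b, G a b p * dirD (e a) (dirD (e b) F) p

/-- The carré du champ `∑ G^{ab} ∂_a F ∂_b H`. -/
def carre {ι : Type*} [Fintype ι] (e : ι → W) (G : ι → ι → W → ℝ) (F H : W → ℝ) (p : W) : ℝ :=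
  ∑ a, ∑ b, G a b p * (dirD (e a) F p * dirD (e b) H p)

variable {ι : Type*} [Fintype ι] {τ : W} {e : ι → W} {G : ι → ι → W → ℝ}

lemma heatOp_mul (hΩ : IsOpen Ω) {F H : W → ℝ} (hF : ContDiffOn ℝ ∞ F Ω)
    (hH : ContDiffOn ℝ ∞ H Ω) {p : W} (hp : p ∈ Ω) (hG : ∀ a b, G a b p = G b a p) :
    heatOp τ e G (fun q => F q * H q) p =
      F p * heatOp τ e G H p + H p * heatOp τ e G F p - 2 * carre e G F H p := by
  have hswap : carre e G F H p = ∑ a, ∑ b, G a b p * (dirD (e b) F p * dirD (e a) H p) := by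
    rw [carre, Finset.sum_comm]
    exact Finset.sum_congr rfl fun a _ => Finset.sum_congr rfl fun b _ => by rw [hG]
  rw [two_mul]
  nth_rewrite 1 [hswap]
  simp only [heatOp, carre, dirD_dirD_mul hΩ hF hH _ _ hp,
    dirD_mul (differentiableAt_of_smooth hΩ hF hp) (differentiableAt_of_smooth hΩ hH hp),
    mul_sub, Finset.mul_sum]
  rw [← sub_eq_zero]
  have : ∀ x₁ x₂ s₁ s₂ s₃ s₄ s : ℝ, s = s₁ + s₂ + s₃ + s₄ →
      x₁ + x₂ - s - (x₁ - s₁ + (x₂ - s₂) - (s₃ + s₄)) = 0 := by intros; linarith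
  rw [mul_comm (H p)]
  apply this
  simp only [← Finset.sum_add_distrib]
  exact Finset.sum_congr rfl fun a _ => Finset.sum_congr rfl fun b _ => by ring

lemma heatOp_sum (hΩ : IsOpen Ω) {κ : Type*} (s : Finset κ) {F : κ → W → ℝ}
    (hF : ∀ i ∈ s, ContDiffOn ℝ ∞ (F i) Ω) {p : W} (hp : p ∈ Ω) :
    heatOp τ e G (fun q => ∑ i ∈ s, F i q) p = ∑ i ∈ s, heatOp τ e G (F i) p := by
  simp only [heatOp, dirD_dirD_sum hΩ s hF _ _ hp,
    dirD_sum s (fun i hi => differentiableAt_of_smooth hΩ (hF i hi) hp), Finset.sum_sub_distrib,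
    Finset.mul_sum]
  congr 1
  rw [Finset.sum_comm (s := s)]
  exact Finset.sum_congr rfl fun a _ => Finset.sum_comm

lemma heatOp_const_add_mul (hΩ : IsOpen Ω) {F : W → ℝ} (hF : ContDiffOn ℝ ∞ F Ω) (c L : ℝ)
    {p : W} (hp : p ∈ Ω) :
    heatOp τ e G (fun q => c + L * F q) p = L * heatOp τ e G F p := by
  simp only [heatOp, dirD_dirD_const_add_mul hΩ hF c L _ _ hp,
    dirD_const_add_mul (differentiableAt_of_smooth hΩ hF hp), mul_sub, Finset.mul_sum]
  congr 1
  exact Finset.sum_congr rfl fun a _ => Finset.sum_congr rfl fun b _ => by ring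

lemma heatOp_dirD (hΩ : IsOpen Ω) {F : W → ℝ} (hF : ContDiffOn ℝ ∞ F Ω)
    (hG : ∀ a b, ContDiffOn ℝ ∞ (G a b) Ω) (v : W) {p : W} (hp : p ∈ Ω) :
    heatOp τ e G (dirD v F) p = dirD v (heatOp τ e G F) p
      + ∑ a, ∑ b, dirD v (G a b) p * dirD (e a) (dirD (e b) F) p := by
  have hG' : ∀ a b, DifferentiableAt ℝ (G a b) p := fun a b =>
    differentiableAt_of_smooth hΩ (hG a b) hp
  have h2 : ∀ a b, DifferentiableAt ℝ (dirD (e a) (dirD (e b) F)) p := fun a b =>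
    differentiableAt_of_smooth hΩ (smooth_dirD hΩ (smooth_dirD hΩ hF _) _) hp
  have h1 : DifferentiableAt ℝ (dirD τ F) p :=
    differentiableAt_of_smooth hΩ (smooth_dirD hΩ hF _) hp
  have hcomm : ∀ a b, dirD (e a) (dirD (e b) (dirD v F)) p
      = dirD v (dirD (e a) (dirD (e b) F)) p := fun a b => by
    rw [dirD_congr hΩ (dirD_comm hΩ hF (e b) v) (e a) hp,
      dirD_comm hΩ (smooth_dirD hΩ hF (e b)) (e a) v hp]
  have hR : dirD v (heatOp τ e G F) p = dirD v (dirD τ F) p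
      - ∑ a, ∑ b, (G a b p * dirD v (dirD (e a) (dirD (e b) F)) p
        + dirD v (G a b) p * dirD (e a) (dirD (e b) F) p) := by
    change dirD v (fun q => dirD τ F q - ∑ a, ∑ b, G a b q * dirD (e a) (dirD (e b) F) q) p = _
    rw [dirD_sub h1 (by fun_prop), dirD_sum _ (by intros; fun_prop)]
    congr 1
    refine Finset.sum_congr rfl fun a _ => ?_
    rw [dirD_sum _ (by intros; fun_prop)]
    exact Finset.sum_congr rfl fun b _ => dirD_mul (hG' a b) (h2 a b) v
  rw [hR]
  simp only [heatOp, hcomm, Finset.sum_add_distrib, dirD_comm hΩ hF τ v hp]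
  ring

/-- `F` is differentiable at `p`, bounded there by `A`, with `v`-derivative bounded by `B`. -/
structure JetBound (v : W) (p : W) (F : W → ℝ) (A B : ℝ) : Prop where
  diff : DifferentiableAt ℝ F p
  val : |F p| ≤ A
  der : |dirD v F p| ≤ B

namespace JetBound

variable {v p : W} {F H : W → ℝ} {A B A' B' : ℝ}

lemma add (hF : JetBound v p F A B) (hH : JetBound v p H A' B') :
    JetBound v p (fun q => F q + H q) (A + A') (B + B') where
  diff := hF.diff.add hH.diff
  val := (abs_add_le _ _).trans (add_le_add hF.val hH.val)
  der := by
    rw [dirD_add hF.diff hH.diff]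
    exact (abs_add_le _ _).trans (add_le_add hF.der hH.der)

lemma sub (hF : JetBound v p F A B) (hH : JetBound v p H A' B') :
    JetBound v p (fun q => F q - H q) (A + A') (B + B') where
  diff := hF.diff.sub hH.diff
  val := (abs_sub _ _).trans (add_le_add hF.val hH.val)
  der := by
    rw [dirD_sub hF.diff hH.diff]
    exact (abs_sub _ _).trans (add_le_add hF.der hH.der)

lemma mul (hF : JetBound v p F A B) (hH : JetBound v p H A' B') :
    JetBound v p (fun q => F q * H q) (A * A') (A * B' + B * A') where
  diff := hF.diff.mul hH.diff
  val := by
    rw [abs_mul]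
    exact mul_le_mul hF.val hH.val (abs_nonneg _) ((abs_nonneg _).trans hF.val)
  der := by
    rw [dirD_mul hF.diff hH.diff]
    refine (abs_add_le _ _).trans ?_
    rw [abs_mul, abs_mul]
    exact add_le_add (mul_le_mul hF.val hH.der (abs_nonneg _) ((abs_nonneg _).trans hF.val))
      (mul_le_mul hF.der hH.val (abs_nonneg _) ((abs_nonneg _).trans hF.der))

lemma const_mul {c : ℝ} (hc : 0 ≤ c) (hF : JetBound v p F A B) :
    JetBound v p (fun q => c * F q) (c * A) (c * B) where
  diff := hF.diff.const_mul c
  val := by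
    rw [abs_mul, abs_of_nonneg hc]
    exact mul_le_mul_of_nonneg_left hF.val hc
  der := by
    have := dirD_const_add_mul hF.diff 0 c v
    simp only [zero_add] at this
    rw [this, abs_mul, abs_of_nonneg hc]
    exact mul_le_mul_of_nonneg_left hF.der hc

lemma sum {n : ℕ} {F : Fin n → W → ℝ} (hF : ∀ i, JetBound v p (F i) A B) :
    JetBound v p (fun q => ∑ i, F i q) (n * A) (n * B) where
  diff := DifferentiableAt.fun_sum fun i _ => (hF i).diff
  val := by
    refine (Finset.abs_sum_le_sum_abs _ _).trans ?_
    exact (Finset.sum_le_sum fun i _ => (hF i).val).trans (by simp)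
  der := by
    rw [dirD_sum _ fun i _ => (hF i).diff]
    refine (Finset.abs_sum_le_sum_abs _ _).trans ?_
    exact (Finset.sum_le_sum fun i _ => (hF i).der).trans (by simp)

end JetBound

end Calculus

section MatrixBounds

variable {n : ℕ}

lemma abs_inverse_sub_one_le {A B : Matrix (Fin n) (Fin n) ℝ} (hAB : A * B = 1) {ε : ℝ}
    (hA : ∀ i j, |A i j - (1 : Matrix (Fin n) (Fin n) ℝ) i j| ≤ ε) (hε : n * ε ≤ 1 / 2)
    (i j : Fin n) : |B i j - (1 : Matrix (Fin n) (Fin n) ℝ) i j| ≤ 2 * (n * ε) := by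
  have hε0 : 0 ≤ ε := (abs_nonneg _).trans (hA i j)
  obtain ⟨⟨k, l⟩, -, hM⟩ := Finset.exists_max_image (Finset.univ : Finset (Fin n × Fin n))
    (fun q => |B q.1 q.2|) ⟨(i, j), Finset.mem_univ _⟩
  set M := |B k l| with hMdef
  have hM' : ∀ a b, |B a b| ≤ M := fun a b => hM (a, b) (Finset.mem_univ _)
  have key : ∀ a b, |B a b - (1 : Matrix (Fin n) (Fin n) ℝ) a b| ≤ n * (ε * M) := fun a b => by
    have h1 : B a b - (1 : Matrix (Fin n) (Fin n) ℝ) a b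
        = -∑ c, (A a c - (1 : Matrix (Fin n) (Fin n) ℝ) a c) * B c b := by
      have h2 : ((A - 1) * B) a b = (1 - B) a b := by rw [sub_mul, hAB, one_mul]
      rw [Matrix.mul_apply] at h2
      simp only [Matrix.sub_apply] at h2
      rw [h2]; ring
    rw [h1, abs_neg]
    refine (Finset.abs_sum_le_sum_abs _ _).trans ?_
    refine (Finset.sum_le_sum (g := fun _ => ε * M) fun c _ => ?_).trans (by simp)
    rw [abs_mul]
    exact mul_le_mul (hA a c) (hM' c b) (abs_nonneg _) hε0
  have hM0 : 0 ≤ M := abs_nonneg _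
  have hone : |(1 : Matrix (Fin n) (Fin n) ℝ) k l| ≤ 1 := by
    rw [Matrix.one_apply]; split_ifs <;> simp
  have hM2 : M ≤ 2 := by
    have h3 := key k l
    have h4 := abs_sub_abs_le_abs_sub (B k l) ((1 : Matrix (Fin n) (Fin n) ℝ) k l)
    nlinarith
  refine (key i j).trans ?_
  have : 0 ≤ (n : ℝ) * ε := by positivity
  nlinarith

lemma quadForm_lower_bound {G : Fin n → Fin n → ℝ} {η : ℝ}
    (hG : ∀ i j, |G i j - (1 : Matrix (Fin n) (Fin n) ℝ) i j| ≤ η) (y : Fin n → ℝ) :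
    (1 - n * η) * ∑ a, y a ^ 2 ≤ ∑ a, ∑ b, G a b * (y a * y b) := by
  have h1 : ∀ a b, (1 : Matrix (Fin n) (Fin n) ℝ) a b * (y a * y b)
      - η * ((y a ^ 2 + y b ^ 2) / 2) ≤ G a b * (y a * y b) := fun a b => by
    have h2 : |(G a b - (1 : Matrix (Fin n) (Fin n) ℝ) a b) * (y a * y b)|
        ≤ η * ((y a ^ 2 + y b ^ 2) / 2) := by
      rw [abs_mul]
      refine mul_le_mul (hG a b) ?_ (abs_nonneg _) ((abs_nonneg _).trans (hG a b))
      rw [abs_le]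
      constructor <;> nlinarith [sq_nonneg (y a + y b), sq_nonneg (y a - y b)]
    have := (abs_le.1 h2).1
    linarith
  refine le_trans (le_of_eq ?_) (Finset.sum_le_sum fun a _ => Finset.sum_le_sum fun b _ => h1 a b)
  simp only [Finset.sum_sub_distrib, ← Finset.mul_sum, ← Finset.sum_div, Finset.sum_add_distrib]
  simp [Matrix.one_apply, ← Finset.mul_sum]
  simp only [← pow_two]
  ring

end MatrixBounds

lemma abs_le_sqrt_sum₃ {n : ℕ} (f : Fin n → Fin n → Fin n → ℝ) (a i j : Fin n) :
    |f a i j| ≤ √(∑ a, ∑ i, ∑ j, f a i j ^ 2) := by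
  apply Real.abs_le_sqrt
  calc f a i j ^ 2 ≤ ∑ j, f a i j ^ 2 :=
        Finset.single_le_sum (f := fun j => f a i j ^ 2) (fun _ _ => by positivity)
          (Finset.mem_univ j)
    _ ≤ ∑ i, ∑ j, f a i j ^ 2 :=
        Finset.single_le_sum (f := fun i => ∑ j, f a i j ^ 2) (fun _ _ => by positivity)
          (Finset.mem_univ i)
    _ ≤ _ :=
        Finset.single_le_sum (f := fun a => ∑ i, ∑ j, f a i j ^ 2) (fun _ _ => by positivity)
          (Finset.mem_univ a)

lemma abs_sum_le_card_mul {n : ℕ} {f : Fin n → ℝ} {c : ℝ} (hf : ∀ i, |f i| ≤ c) :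
    |∑ i, f i| ≤ n * c :=
  (Finset.abs_sum_le_sum_abs _ _).trans ((Finset.sum_le_sum fun i _ => hf i).trans (by simp))

/-- The absorption argument: the good terms `-|∂²g|²` and `-L|∂g|⁴` beat the error terms. -/
lemma absorb_error_terms {d h u C L E Pu Pv Γ : ℝ} (hC : 0 ≤ C)
    (hL : L = 2 * C + 4 * C ^ 2 + 1) (hu0 : 0 ≤ u) (hu : L * u ≤ 1)
    (hPu : Pu ≤ -(3 / 2) * d ^ 2)
    (hPv : Pv ≤ C * (d ^ 4 + d ^ 2 * h) - 7 / 4 * h ^ 2)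
    (hh : 0 ≤ h) (hΓ : |Γ| ≤ E * (d ^ 2 * h)) (hE : 2 * L * E ≤ 1) :
    (1 + L * u) * Pv + d ^ 2 * (L * Pu) - 2 * (L * Γ) ≤ -h ^ 2 - L / 2 * (d ^ 2) ^ 2 := by
  have hL0 : 0 ≤ L := by rw [hL]; positivity
  have hLu : 0 ≤ L * u := by positivity
  have hB : 0 ≤ C * (d ^ 4 + d ^ 2 * h) := by positivity
  have h1 : (1 + L * u) * Pv ≤ 2 * (C * (d ^ 4 + d ^ 2 * h)) - 7 / 4 * h ^ 2 := by
    have := mul_le_mul_of_nonneg_left hPv (by linarith : 0 ≤ 1 + L * u)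
    nlinarith [mul_nonneg hLu (sq_nonneg h)]
  have h2 : d ^ 2 * (L * Pu) ≤ -(3 / 2) * L * d ^ 4 := by
    have := mul_le_mul_of_nonneg_left hPu (by positivity : 0 ≤ d ^ 2 * L)
    nlinarith
  have h3 : -(2 * (L * Γ)) ≤ d ^ 2 * h := by
    have h4 := (abs_le.1 hΓ).1
    have h5 := mul_le_mul_of_nonneg_right hE (by positivity : 0 ≤ d ^ 2 * h)
    nlinarith [mul_le_mul_of_nonneg_left h4 hL0]
  have h6 : 2 * C * (d ^ 2 * h) ≤ 1 / 4 * h ^ 2 + 4 * C ^ 2 * d ^ 4 := by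
    nlinarith [sq_nonneg (1 / 2 * h - 2 * C * d ^ 2)]
  have h7 : d ^ 2 * h ≤ 1 / 4 * h ^ 2 + d ^ 4 := by
    nlinarith [sq_nonneg (1 / 2 * h - d ^ 2)]
  rw [hL] at h2 ⊢
  nlinarith [sq_nonneg h]

section Evolution

variable {W : Type*} [NormedAddCommGroup W] [NormedSpace ℝ W] {Ω : Set W} {n : ℕ}
  {τ : W} {e : Fin n → W} {g G : Fin n → Fin n → W → ℝ}

/-- The gradient terms on the right-hand side of the flat Ricci–DeTurck equation. -/
def gradTerm (e : Fin n → W) (g G : Fin n → Fin n → W → ℝ) (i j : Fin n) (x : W) : ℝ :=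
  (1/2) * ∑ a, ∑ b, ∑ p, ∑ q, G a b x * G p q x *
    ( dirD (e i) (g p a) x * dirD (e j) (g q b) x
      + 2 * dirD (e a) (g j p) x * dirD (e q) (g i b) x
      - 2 * dirD (e a) (g j p) x * dirD (e b) (g i q) x
      - 2 * dirD (e j) (g p a) x * dirD (e b) (g i q) x
      - 2 * dirD (e i) (g p a) x * dirD (e b) (g j q) x )

lemma gradTerm_jetBound {v x : W} {d h : ℝ}
    (hG : ∀ a b, JetBound v x (G a b) 2 (n * (n * (4 * d))))
    (hD : ∀ a i j, JetBound v x (dirD (e a) (g i j)) d h) (i j : Fin n) :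
    JetBound v x (gradTerm e g G i j) (18 * n ^ 4 * d ^ 2)
      (72 * n ^ 6 * d ^ 3 + 36 * n ^ 4 * (d * h)) := by
  have h2 : ∀ a i j, JetBound v x (fun q => 2 * dirD (e a) (g i j) q) (2 * d) (2 * h) :=
    fun a i j => (hD a i j).const_mul (by norm_num)
  have key := JetBound.const_mul (c := 1 / 2) (by norm_num) <|
    JetBound.sum fun a => JetBound.sum fun b => JetBound.sum fun p => JetBound.sum fun q =>
    ((hG a b).mul (hG p q)).mul <|
      (((((hD i p a).mul (hD j q b)).add ((h2 a j p).mul (hD q i b))).sub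
        ((h2 a j p).mul (hD b i q))).sub ((h2 j p a).mul (hD b i q))).sub
        ((h2 i p a).mul (hD b j q))
  refine ⟨key.diff, key.val.trans (le_of_eq ?_), key.der.trans (le_of_eq ?_)⟩ <;> ring

lemma dirD_sub_const (F : W → ℝ) (c : ℝ) (v : W) :
    dirD v (fun q => F q - c) = dirD v F := by
  funext p
  simp only [dirD, fderiv_sub_const]

lemma heatOp_sub_const (F : W → ℝ) (c : ℝ) :
    heatOp τ e G (fun q => F q - c) = heatOp τ e G F := by
  funext p
  simp only [heatOp, dirD_sub_const]

lemma heatOp_sq (hΩ : IsOpen Ω) {F : W → ℝ} (hF : ContDiffOn ℝ ∞ F Ω) {p : W} (hp : p ∈ Ω)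
    (hG : ∀ a b, G a b p = G b a p) :
    heatOp τ e G (fun q => F q ^ 2) p = 2 * (F p * heatOp τ e G F p - carre e G F F p) := by
  simp only [pow_two]
  rw [heatOp_mul hΩ hF hF hp hG]
  ring

lemma abs_dirD_inverse_le (hΩ : IsOpen Ω) (hg : ∀ i j, ContDiffOn ℝ ∞ (g i j) Ω)
    (hG : ∀ i j, ContDiffOn ℝ ∞ (G i j) Ω)
    (hinv : ∀ q ∈ Ω, (Matrix.of fun i j => G i j q) * (Matrix.of fun i j => g i j q) = 1)
    {p v : W} (hp : p ∈ Ω) {d : ℝ} (hd : ∀ i j, |dirD v (g i j) p| ≤ d)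
    (hG2 : ∀ i j, |G i j p| ≤ 2) (a b : Fin n) :
    |dirD v (G a b) p| ≤ n * (n * (4 * d)) := by
  have hg' := fun i j => differentiableAt_of_smooth hΩ (hg i j) hp
  have hG' := fun i j => differentiableAt_of_smooth hΩ (hG i j) hp
  set A : Matrix (Fin n) (Fin n) ℝ := Matrix.of fun i j => dirD v (g i j) p with hA
  set M : Matrix (Fin n) (Fin n) ℝ := Matrix.of fun i j => dirD v (G i j) p with hM
  set Gp : Matrix (Fin n) (Fin n) ℝ := Matrix.of fun i j => G i j p with hGp
  set gp : Matrix (Fin n) (Fin n) ℝ := Matrix.of fun i j => g i j p with hgp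
  have h1 : Gp * A + M * gp = 0 := by
    ext i j
    have h2 : EqOn (fun q => ∑ k, G i k q * g k j q)
        (fun _ => (1 : Matrix (Fin n) (Fin n) ℝ) i j) Ω := fun q hq => by
      have := congrFun (congrFun (hinv q hq) i) j
      simpa [Matrix.mul_apply] using this
    have h3 := dirD_congr hΩ h2 v hp
    rw [dirD_const, dirD_sum _ (fun k _ => (hG' i k).fun_mul (hg' k j))] at h3
    simp only [dirD_mul (hG' _ _) (hg' _ _), Finset.sum_add_distrib] at h3
    simpa [Matrix.mul_apply, hA, hM, hGp, hgp, add_comm] using h3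
  have h4 : M = -(Gp * A * Gp) := by
    have h5 : gp * Gp = 1 := mul_eq_one_comm.1 (hinv p hp)
    calc M = M * (gp * Gp) := by rw [h5, mul_one]
      _ = (Gp * A + M * gp) * Gp - Gp * A * Gp := by noncomm_ring
      _ = _ := by rw [h1]; simp
  have h6 : dirD v (G a b) p = -∑ l, ∑ k, Gp a k * A k l * Gp l b := by
    have := congrFun (congrFun h4 a) b
    simpa [Matrix.mul_apply, Finset.sum_mul, hM] using this
  rw [h6, abs_neg]
  refine abs_sum_le_card_mul fun l => abs_sum_le_card_mul fun k => ?_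
  rw [abs_mul, abs_mul]
  have h7 := mul_le_mul (hG2 a k) (hd k l) (abs_nonneg _) (by norm_num)
  have h8 := mul_le_mul h7 (hG2 l b) (abs_nonneg _) ((by positivity : (0:ℝ) ≤ _).trans h7)
  exact h8.trans (by linarith)

/-- Squared Frobenius distance of the matrix field `g` to the identity. -/
def distSq (g : Fin n → Fin n → W → ℝ) (q : W) : ℝ :=
  ∑ i, ∑ j, (g i j q - (1 : Matrix (Fin n) (Fin n) ℝ) i j) ^ 2

/-- Squared norm of the first derivatives of `g` in the directions `e`. -/
def gradNormSq (e : Fin n → W) (g : Fin n → Fin n → W → ℝ) (q : W) : ℝ :=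
  ∑ a, ∑ i, ∑ j, dirD (e a) (g i j) q ^ 2

/-- Squared norm of the second derivatives of `g` in the directions `e`. -/
def hessNormSq (e : Fin n → W) (g : Fin n → Fin n → W → ℝ) (q : W) : ℝ :=
  ∑ a, ∑ b, ∑ i, ∑ j, dirD (e a) (dirD (e b) (g i j)) q ^ 2

lemma smooth_distSq (hg : ∀ i j, ContDiffOn ℝ ∞ (g i j) Ω) : ContDiffOn ℝ ∞ (distSq g) Ω :=
  ContDiffOn.sum fun i _ => ContDiffOn.sum fun j _ => ((hg i j).sub contDiffOn_const).pow 2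

lemma smooth_gradNormSq (hΩ : IsOpen Ω) (hg : ∀ i j, ContDiffOn ℝ ∞ (g i j) Ω) :
    ContDiffOn ℝ ∞ (gradNormSq e g) Ω :=
  ContDiffOn.sum fun a _ => ContDiffOn.sum fun i _ => ContDiffOn.sum fun j _ =>
    (smooth_dirD hΩ (hg i j) (e a)).pow 2

lemma gradNormSq_nonneg (e : Fin n → W) (g : Fin n → Fin n → W → ℝ) (q : W) :
    0 ≤ gradNormSq e g q :=
  Finset.sum_nonneg fun _ _ => Finset.sum_nonneg fun _ _ => Finset.sum_nonneg fun _ _ =>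
    sq_nonneg _

lemma hessNormSq_nonneg (e : Fin n → W) (g : Fin n → Fin n → W → ℝ) (q : W) :
    0 ≤ hessNormSq e g q :=
  Finset.sum_nonneg fun _ _ => Finset.sum_nonneg fun _ _ => Finset.sum_nonneg fun _ _ =>
    Finset.sum_nonneg fun _ _ => sq_nonneg _

lemma heatOp_weighted_gradient_le (hΩ : IsOpen Ω) (hg : ∀ i j, ContDiffOn ℝ ∞ (g i j) Ω)
    (hG : ∀ i j, ContDiffOn ℝ ∞ (G i j) Ω)
    (hinv : ∀ q ∈ Ω, (Matrix.of fun i j => G i j q) * (Matrix.of fun i j => g i j q) = 1)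
    (hsymm : ∀ q ∈ Ω, ∀ a b, G a b q = G b a q)
    (hflow : ∀ q ∈ Ω, ∀ i j, heatOp τ e G (g i j) q = gradTerm e g G i j q)
    {L ε : ℝ} (hL : L = 2 * (144 * (n : ℝ) ^ 9) + 4 * (144 * (n : ℝ) ^ 9) ^ 2 + 1)
    (hn : 1 ≤ (n : ℝ)) (hε : 0 < ε) (hLε : 144 * n ^ 9 * (L * ε) ≤ 1) {p : W} (hp : p ∈ Ω)
    (hclose : distSq g p ≤ ε ^ 2) :
    heatOp τ e G (fun q => (1 + L * distSq g q) * gradNormSq e g q) p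
      ≤ -hessNormSq e g p - L / 2 * gradNormSq e g p ^ 2 := by
  -- numerical consequences of the choice of `ε`
  have hL1 : 1 ≤ L := by
    rw [hL]
    nlinarith [sq_nonneg (144 * (n : ℝ) ^ 9), pow_nonneg (zero_le_one.trans hn) 9]
  have hpow : ∀ k ≤ 9, (n : ℝ) ^ k ≤ (n : ℝ) ^ 9 := fun k hk => pow_le_pow_right₀ hn hk
  have hm1 : 1 ≤ (n : ℝ) ^ 9 := one_le_pow₀ hn
  have hεLε : ε ≤ L * ε := by nlinarith
  have hsmallL : ∀ k ≤ 9, 144 * ((n : ℝ) ^ k * (L * ε)) ≤ 1 := fun k hk => by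
    have := mul_le_mul_of_nonneg_right (hpow k hk) (by positivity : 0 ≤ L * ε)
    linarith
  have hsmall : ∀ k ≤ 9, 144 * ((n : ℝ) ^ k * ε) ≤ 1 := fun k hk => by
    have := mul_le_mul_of_nonneg_left hεLε (by positivity : 0 ≤ (n : ℝ) ^ k)
    linarith [hsmallL k hk]
  have hε1 : ε ≤ 1 := by have := hsmall 0 (by norm_num); simp at this; linarith
  have hLε2 : L * ε ^ 2 ≤ 1 := by
    have := hsmallL 0 (by norm_num)
    simp at this
    nlinarith
  -- pointwise quantities
  have hu0 : 0 ≤ distSq g p :=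
    Finset.sum_nonneg fun _ _ => Finset.sum_nonneg fun _ _ => sq_nonneg _
  obtain ⟨d, hd⟩ : ∃ d, d = √(gradNormSq e g p) := ⟨_, rfl⟩
  obtain ⟨h, hh⟩ : ∃ h, h = √(hessNormSq e g p) := ⟨_, rfl⟩
  have hd2 : d ^ 2 = gradNormSq e g p := by
    rw [hd]; exact Real.sq_sqrt (gradNormSq_nonneg e g p)
  have hh2 : h ^ 2 = hessNormSq e g p := by
    rw [hh]; exact Real.sq_sqrt (hessNormSq_nonneg e g p)
  have hd0 : 0 ≤ d := hd ▸ Real.sqrt_nonneg _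
  have hh0 : 0 ≤ h := hh ▸ Real.sqrt_nonneg _
  have hD : ∀ a i j, |dirD (e a) (g i j) p| ≤ d := fun a i j =>
    hd ▸ abs_le_sqrt_sum₃ (fun a i j => dirD (e a) (g i j) p) a i j
  have hHb : ∀ a b i j, |dirD (e a) (dirD (e b) (g i j)) p| ≤ h := fun a b i j => by
    refine (abs_le_sqrt_sum₃ (fun b i j => dirD (e a) (dirD (e b) (g i j)) p) b i j).trans ?_
    rw [hh]
    exact Real.sqrt_le_sqrt (Finset.single_le_sum
      (f := fun a => ∑ b, ∑ i, ∑ j, dirD (e a) (dirD (e b) (g i j)) p ^ 2)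
      (fun _ _ => Finset.sum_nonneg fun _ _ => Finset.sum_nonneg fun _ _ =>
        Finset.sum_nonneg fun _ _ => sq_nonneg _) (Finset.mem_univ a))
  have hfb : ∀ i j, |g i j p - (1 : Matrix (Fin n) (Fin n) ℝ) i j| ≤ ε := fun i j => by
    refine abs_le_of_sq_le_sq ?_ hε.le
    refine le_trans ?_ hclose
    exact (Finset.single_le_sum
      (f := fun j => (g i j p - (1 : Matrix (Fin n) (Fin n) ℝ) i j) ^ 2)
      (fun _ _ => by positivity) (Finset.mem_univ j)).trans (Finset.single_le_sum
      (f := fun i => ∑ j, (g i j p - (1 : Matrix (Fin n) (Fin n) ℝ) i j) ^ 2)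
      (fun _ _ => by positivity) (Finset.mem_univ i))
  have hmε : (n : ℝ) * ε ≤ 1 / 144 := by
    have := hsmall 1 (by norm_num)
    rw [pow_one] at this
    linarith
  have hG1 : ∀ a b, |G a b p - (1 : Matrix (Fin n) (Fin n) ℝ) a b| ≤ 2 * ((n : ℝ) * ε) :=
    abs_inverse_sub_one_le (mul_eq_one_comm.1 (hinv p hp)) hfb (by linarith)
  have hG2 : ∀ a b, |G a b p| ≤ 2 := fun a b => by
    have h1 := hG1 a b
    have h2 : |(1 : Matrix (Fin n) (Fin n) ℝ) a b| ≤ 1 := by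
      rw [Matrix.one_apply]; split_ifs <;> simp
    have h3 := abs_sub_abs_le_abs_sub (G a b p) ((1 : Matrix (Fin n) (Fin n) ℝ) a b)
    linarith
  have hcarre : ∀ F : W → ℝ, 7 / 8 * ∑ a, dirD (e a) F p ^ 2 ≤ carre e G F F p := fun F => by
    refine le_trans ?_ (quadForm_lower_bound hG1 fun a => dirD (e a) F p)
    refine mul_le_mul_of_nonneg_right ?_ (by positivity)
    have := hsmall 2 (by norm_num)
    nlinarith
  -- smoothness
  have hf : ∀ i j, ContDiffOn ℝ ∞ (fun q => g i j q - (1 : Matrix (Fin n) (Fin n) ℝ) i j) Ω :=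
    fun i j => (hg i j).sub contDiffOn_const
  have hDs : ∀ a i j, ContDiffOn ℝ ∞ (dirD (e a) (g i j)) Ω := fun a i j =>
    smooth_dirD hΩ (hg i j) (e a)
  have hus : ContDiffOn ℝ ∞ (distSq g) Ω := smooth_distSq hg
  have hws : ContDiffOn ℝ ∞ (gradNormSq e g) Ω := smooth_gradNormSq hΩ hg
  -- jets
  have hDjet : ∀ c a i j, JetBound (e c) p (dirD (e a) (g i j)) d h := fun c a i j =>
    ⟨differentiableAt_of_smooth hΩ (hDs a i j) hp, hD a i j, hHb c a i j⟩
  have hfjet : ∀ c i j,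
      JetBound (e c) p (fun q => g i j q - (1 : Matrix (Fin n) (Fin n) ℝ) i j) ε d :=
    fun c i j => ⟨differentiableAt_of_smooth hΩ (hf i j) hp, hfb i j, by
      rw [dirD_sub_const]; exact hD c i j⟩
  have hdG : ∀ c a b, |dirD (e c) (G a b) p| ≤ (n : ℝ) * ((n : ℝ) * (4 * d)) := fun c =>
    abs_dirD_inverse_le hΩ hg hG hinv hp (hD c) hG2
  have hGjet : ∀ c a b, JetBound (e c) p (G a b) 2 ((n : ℝ) * ((n : ℝ) * (4 * d))) := fun c a b =>
    ⟨differentiableAt_of_smooth hΩ (hG a b) hp, hG2 a b, hdG c a b⟩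
  have hQ : ∀ c i j, JetBound (e c) p (gradTerm e g G i j) (18 * (n : ℝ) ^ 4 * d ^ 2)
      (72 * (n : ℝ) ^ 6 * d ^ 3 + 36 * (n : ℝ) ^ 4 * (d * h)) := fun c =>
    gradTerm_jetBound (hGjet c) (hDjet c)
  -- evolution of `|g - δ|²`
  have hPu : heatOp τ e G (distSq g) p ≤ -(3 / 2) * d ^ 2 := by
    have h1 : heatOp τ e G (distSq g) p = ∑ i, ∑ j,
        2 * ((g i j p - (1 : Matrix (Fin n) (Fin n) ℝ) i j) * gradTerm e g G i j p
          - carre e G (g i j) (g i j) p) := by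
      unfold distSq
      rw [heatOp_sum hΩ _ (fun i _ => ContDiffOn.sum fun j _ => (hf i j).pow 2) hp]
      refine Finset.sum_congr rfl fun i _ => ?_
      rw [heatOp_sum hΩ _ (fun j _ => (hf i j).pow 2) hp]
      refine Finset.sum_congr rfl fun j _ => ?_
      rw [heatOp_sq hΩ (hf i j) hp (hsymm p hp), heatOp_sub_const, hflow p hp]
      simp only [carre, dirD_sub_const]
    have h2 : ∀ i j, 2 * ((g i j p - (1 : Matrix (Fin n) (Fin n) ℝ) i j) * gradTerm e g G i j p
          - carre e G (g i j) (g i j) p)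
        ≤ 36 * (n : ℝ) ^ 4 * ε * d ^ 2 - 7 / 4 * ∑ a, dirD (e a) (g i j) p ^ 2 := fun i j => by
      have h3 := abs_le.1 ((abs_mul _ _).le.trans
        (mul_le_mul (hfb i j) (hQ i i j).val (abs_nonneg _) hε.le))
      linarith [hcarre (g i j), h3.2]
    have h4 : ∑ i, ∑ j, ∑ a, dirD (e a) (g i j) p ^ 2 = gradNormSq e g p := by
      unfold gradNormSq
      rw [Finset.sum_comm (f := fun a i => ∑ j, dirD (e a) (g i j) p ^ 2)]
      exact Finset.sum_congr rfl fun i _ => Finset.sum_comm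
    rw [h1]
    refine (Finset.sum_le_sum fun i _ => Finset.sum_le_sum fun j _ => h2 i j).trans ?_
    simp only [Finset.sum_sub_distrib, ← Finset.mul_sum, h4, ← hd2]
    simp only [Finset.sum_const, Finset.card_univ, Fintype.card_fin, nsmul_eq_mul]
    have := mul_le_mul_of_nonneg_right (hsmall 6 (by norm_num)) (sq_nonneg d)
    linarith
  -- evolution of `|∂g|²`
  have hPD : ∀ c i j, |heatOp τ e G (dirD (e c) (g i j)) p|
      ≤ 72 * (n : ℝ) ^ 6 * (d ^ 3 + d * h) := fun c i j => by
    rw [heatOp_dirD hΩ (hg i j) hG (e c) hp,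
      dirD_congr hΩ (fun q hq => hflow q hq i j) (e c) hp]
    have h1 : |∑ a, ∑ b, dirD (e c) (G a b) p * dirD (e a) (dirD (e b) (g i j)) p|
        ≤ (n : ℝ) * ((n : ℝ) * ((n : ℝ) * ((n : ℝ) * (4 * d)) * h)) :=
      abs_sum_le_card_mul fun a => abs_sum_le_card_mul fun b => by
        rw [abs_mul]
        exact mul_le_mul (hdG c a b) (hHb a b i j) (abs_nonneg _) (by positivity)
    refine (abs_add_le _ _).trans ((add_le_add (hQ c i j).der h1).trans ?_)
    have h2 := mul_le_mul_of_nonneg_right (pow_le_pow_right₀ hn (by norm_num : 4 ≤ 6))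
      (by positivity : 0 ≤ d * h)
    have h3 : 0 ≤ (n : ℝ) ^ 6 * (d * h) := by positivity
    linarith
  have hPw : heatOp τ e G (gradNormSq e g) p
      ≤ 144 * (n : ℝ) ^ 9 * (d ^ 4 + d ^ 2 * h) - 7 / 4 * h ^ 2 := by
    have h1 : heatOp τ e G (gradNormSq e g) p = ∑ c, ∑ i, ∑ j,
        2 * (dirD (e c) (g i j) p * heatOp τ e G (dirD (e c) (g i j)) p
          - carre e G (dirD (e c) (g i j)) (dirD (e c) (g i j)) p) := by
      unfold gradNormSq
      rw [heatOp_sum hΩ _ (fun c _ => ContDiffOn.sum fun i _ =>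
        ContDiffOn.sum fun j _ => (hDs c i j).pow 2) hp]
      refine Finset.sum_congr rfl fun c _ => ?_
      rw [heatOp_sum hΩ _ (fun i _ => ContDiffOn.sum fun j _ => (hDs c i j).pow 2) hp]
      refine Finset.sum_congr rfl fun i _ => ?_
      rw [heatOp_sum hΩ _ (fun j _ => (hDs c i j).pow 2) hp]
      exact Finset.sum_congr rfl fun j _ => heatOp_sq hΩ (hDs c i j) hp (hsymm p hp)
    have h2 : ∀ c i j, 2 * (dirD (e c) (g i j) p * heatOp τ e G (dirD (e c) (g i j)) p
          - carre e G (dirD (e c) (g i j)) (dirD (e c) (g i j)) p)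
        ≤ 144 * (n : ℝ) ^ 6 * (d ^ 4 + d ^ 2 * h)
          - 7 / 4 * ∑ a, dirD (e a) (dirD (e c) (g i j)) p ^ 2 := fun c i j => by
      have h3 := abs_le.1 ((abs_mul _ _).le.trans
        (mul_le_mul (hD c i j) (hPD c i j) (abs_nonneg _) hd0))
      linarith [hcarre (dirD (e c) (g i j)), h3.2]
    have h4 : ∑ c, ∑ i, ∑ j, ∑ a, dirD (e a) (dirD (e c) (g i j)) p ^ 2 = hessNormSq e g p := by
      unfold hessNormSq
      rw [Finset.sum_comm (f := fun a c => ∑ i, ∑ j, dirD (e a) (dirD (e c) (g i j)) p ^ 2)]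
      refine Finset.sum_congr rfl fun c _ => ?_
      rw [Finset.sum_comm (f := fun a i => ∑ j, dirD (e a) (dirD (e c) (g i j)) p ^ 2)]
      exact Finset.sum_congr rfl fun i _ => Finset.sum_comm
    rw [h1]
    refine (Finset.sum_le_sum fun c _ => Finset.sum_le_sum fun i _ =>
      Finset.sum_le_sum fun j _ => h2 c i j).trans (le_of_eq ?_)
    simp only [Finset.sum_sub_distrib, ← Finset.mul_sum, h4, ← hh2]
    simp only [Finset.sum_const, Finset.card_univ, Fintype.card_fin, nsmul_eq_mul]
    ring
  -- the cross term
  have hΓ : |carre e G (distSq g) (gradNormSq e g) p| ≤ 8 * (n : ℝ) ^ 7 * ε * (d ^ 2 * h) := by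
    have h1 : ∀ c, |dirD (e c) (distSq g) p| ≤ 2 * (n : ℝ) ^ 2 * ε * d := fun c => by
      have := (JetBound.sum fun i => JetBound.sum fun j => (hfjet c i j).mul (hfjet c i j)).der
      simp only [← pow_two] at this
      exact this.trans (le_of_eq (by ring))
    have h2 : ∀ c, |dirD (e c) (gradNormSq e g) p| ≤ 2 * (n : ℝ) ^ 3 * (d * h) := fun c => by
      have := (JetBound.sum fun a => JetBound.sum fun i => JetBound.sum fun j =>
        (hDjet c a i j).mul (hDjet c a i j)).der
      simp only [← pow_two] at this
      exact this.trans (le_of_eq (by ring))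
    refine (abs_sum_le_card_mul
      (c := (n : ℝ) * (2 * (2 * (n : ℝ) ^ 2 * ε * d * (2 * (n : ℝ) ^ 3 * (d * h)))))
      fun a => abs_sum_le_card_mul fun b => ?_).trans (le_of_eq (by ring))
    rw [abs_mul, abs_mul]
    exact mul_le_mul (hG2 a b) (mul_le_mul (h1 a) (h2 b) (abs_nonneg _) (by positivity))
      (by positivity) (by norm_num)
  have hmain := absorb_error_terms (C := 144 * (n : ℝ) ^ 9) (by positivity) hL hu0
    ((mul_le_mul_of_nonneg_left hclose (by positivity)).trans hLε2) hPu hPw hh0 hΓ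
    (by linarith [hsmallL 7 (by norm_num), (by positivity : 0 ≤ (n : ℝ) ^ 7 * (L * ε))])
  rw [heatOp_mul hΩ (contDiffOn_const.add (contDiffOn_const.mul hus)) hws hp (hsymm p hp),
    heatOp_const_add_mul hΩ hus 1 L hp]
  have hcross : carre e G (fun q => 1 + L * distSq g q) (gradNormSq e g) p
      = L * carre e G (distSq g) (gradNormSq e g) p := by
    simp only [carre, dirD_const_add_mul (differentiableAt_of_smooth hΩ hus hp), Finset.mul_sum]
    exact Finset.sum_congr rfl fun a _ => Finset.sum_congr rfl fun b _ => by ring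
  rw [hcross, ← hh2, ← hd2]
  exact hmain

end Evolution

section Slices

variable {n : ℕ}

/-- The coordinate directions of `ℝⁿ` as purely spatial directions of space-time. -/
def spaceDir (a : Fin n) : ℝ × Eucl n := (0, EuclideanSpace.single a 1)

lemma deriv_slice {F : ℝ × Eucl n → ℝ} {t : ℝ} {x : Eucl n} (hF : DifferentiableAt ℝ F (t, x)) :
    deriv (fun s => F (s, x)) t = dirD (1, 0) F (t, x) :=
  (hF.hasFDerivAt.comp_hasDerivAt t
    ((hasDerivAt_id t).prodMk (hasDerivAt_const t x))).deriv

lemma pd_slice {F : ℝ × Eucl n → ℝ} {t : ℝ} {x : Eucl n} (hF : DifferentiableAt ℝ F (t, x))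
    (a : Fin n) : pd a (fun y => F (t, y)) x = dirD (spaceDir a) F (t, x) := by
  have h : HasFDerivAt (fun y : Eucl n => F (t, y)) _ x :=
    hF.hasFDerivAt.comp x ((hasFDerivAt_const t x).prodMk (hasFDerivAt_id x))
  rw [pd, h.fderiv]
  simp [dirD, spaceDir]

lemma pd_congr {U : Set (Eucl n)} (hU : IsOpen U) {f k : Eucl n → ℝ} (h : EqOn f k U)
    (a : Fin n) : EqOn (pd a f) (pd a k) U :=
  dirD_congr hU h _

lemma pd_pd_slice {I : Set ℝ} {U : Set (Eucl n)} (hI : IsOpen I) (hU : IsOpen U)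
    {F : ℝ × Eucl n → ℝ} (hF : ContDiffOn ℝ ∞ F (I ×ˢ U)) {t : ℝ} {x : Eucl n} (ht : t ∈ I)
    (hx : x ∈ U) (a b : Fin n) :
    pd a (fun y => pd b (fun z => F (t, z)) y) x
      = dirD (spaceDir a) (dirD (spaceDir b) F) (t, x) := by
  have hΩ := hI.prod hU
  rw [pd_congr hU (fun y hy => pd_slice (differentiableAt_of_smooth hΩ hF ⟨ht, hy⟩) b) a hx]
  exact pd_slice (differentiableAt_of_smooth hΩ (smooth_dirD hΩ hF _) ⟨ht, hx⟩) a

end Slices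

section MatrixSmooth

variable {W : Type*} [NormedAddCommGroup W] [NormedSpace ℝ W] {Ω : Set W} {n : ℕ}

lemma contDiffOn_matrix_det {A : W → Matrix (Fin n) (Fin n) ℝ}
    (hA : ∀ i j, ContDiffOn ℝ ∞ (fun q => A q i j) Ω) : ContDiffOn ℝ ∞ (fun q => (A q).det) Ω := by
  simp only [Matrix.det_apply]
  exact ContDiffOn.sum fun σ _ => (contDiffOn_prod fun i _ => hA (σ i) i).const_smul _

lemma contDiffOn_matrix_inv {A : W → Matrix (Fin n) (Fin n) ℝ}
    (hA : ∀ i j, ContDiffOn ℝ ∞ (fun q => A q i j) Ω) (hdet : ∀ q ∈ Ω, (A q).det ≠ 0)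
    (i j : Fin n) : ContDiffOn ℝ ∞ (fun q => (A q)⁻¹ i j) Ω := by
  simp only [Matrix.inv_def, Ring.inverse_eq_inv', Matrix.smul_apply, smul_eq_mul,
    Matrix.adjugate_apply]
  refine ((contDiffOn_matrix_det hA).inv hdet).mul (contDiffOn_matrix_det fun k l => ?_)
  by_cases h : k = j
  · subst h
    simpa using contDiffOn_const
  · simpa [Matrix.updateRow_ne h] using hA k l

end MatrixSmooth

end RicciDeTurck

open RicciDeTurck in
/-- pointwise evolution inequality for the weighted gradient quantity
`ω = (1 + L|g − δ|²)|∂g|²` along a Ricci–DeTurck flow with flat background: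
`∂_t ω ≤ ∑ g^{ab} ∂_a ∂_b ω − |∂²g|² − (L/2)|∂g|⁴`. -/
theorem omega_evolution_inequality (n : ℕ) (hn : 1 ≤ n) :
    ∃ ε₀ : ℝ, 0 < ε₀ ∧ ∃ L : ℝ, 1 ≤ L ∧
      ∀ (U : Set (Eucl n)), IsOpen U →
      ∀ (I : Set ℝ), IsOpen I → I.OrdConnected →
      ∀ g : ℝ → Eucl n → Matrix (Fin n) (Fin n) ℝ,
        IsRicciDeTurckFlow g I U →
        (∀ t ∈ I, ∀ x ∈ U, Real.sqrt (matDistSq (g t x) 1) ≤ ε₀) →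
        ∀ t ∈ I, ∀ x ∈ U,
          deriv (fun s => (1 + L * matDistSq (g s x) 1) * gradSq g s x) t ≤
            (∑ a, ∑ b, (g t x)⁻¹ a b *
                pd a (fun y =>
                  pd b (fun z => (1 + L * matDistSq (g t z) 1) * gradSq g t z) y) x)
              - hessSq g t x - (L / 2) * (gradSq g t x) ^ 2 := by
  obtain ⟨L, hL⟩ : ∃ L : ℝ, L = 2 * (144 * (n : ℝ) ^ 9) + 4 * (144 * (n : ℝ) ^ 9) ^ 2 + 1 :=
    ⟨_, rfl⟩
  have hn' : (1 : ℝ) ≤ n := by exact_mod_cast hn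
  have hL1 : 1 ≤ L := by rw [hL]; linarith [(by positivity :
    0 ≤ 2 * (144 * (n : ℝ) ^ 9) + 4 * (144 * (n : ℝ) ^ 9) ^ 2)]
  have hpos : 0 < 144 * (n : ℝ) ^ 9 * L := by positivity
  refine ⟨1 / (144 * (n : ℝ) ^ 9 * L), by positivity, L, hL1, ?_⟩
  intro U hU I hI _ g hflow hclose t ht x hx
  obtain ⟨hsmooth, hmetric, heq⟩ := hflow
  set F : Fin n → Fin n → ℝ × Eucl n → ℝ := fun i j p => g p.1 p.2 i j with hF
  set G : Fin n → Fin n → ℝ × Eucl n → ℝ := fun i j p => (g p.1 p.2)⁻¹ i j with hG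
  have hΩ : IsOpen (I ×ˢ U) := hI.prod hU
  have hp : (t, x) ∈ I ×ˢ U := ⟨ht, hx⟩
  have hdet : ∀ q ∈ I ×ˢ U, (g q.1 q.2).det ≠ 0 := fun q hq =>
    (hmetric q.1 hq.1 q.2 hq.2).2.det_pos.ne'
  have hGs : ∀ i j, ContDiffOn ℝ ∞ (G i j) (I ×ˢ U) := contDiffOn_matrix_inv hsmooth hdet
  have hgrad : ∀ s ∈ I, ∀ y ∈ U, gradSq g s y = gradNormSq spaceDir F (s, y) := fun s hs y hy => by
    simp only [gradSq, gradNormSq]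
    refine Finset.sum_congr rfl fun a _ => Finset.sum_congr rfl fun i _ =>
      Finset.sum_congr rfl fun j _ => ?_
    rw [← pd_slice (differentiableAt_of_smooth hΩ (hsmooth i j) ⟨hs, hy⟩)]
  have hhess : hessSq g t x = hessNormSq spaceDir F (t, x) := by
    simp only [hessSq, hessNormSq]
    refine Finset.sum_congr rfl fun a _ => Finset.sum_congr rfl fun b _ =>
      Finset.sum_congr rfl fun i _ => Finset.sum_congr rfl fun j _ => ?_
    rw [← pd_pd_slice hI hU (hsmooth i j) ht hx]
  have hω : ContDiffOn ℝ ∞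
      (fun q => (1 + L * distSq F q) * gradNormSq spaceDir F q) (I ×ˢ U) :=
    (contDiffOn_const.add (contDiffOn_const.mul (smooth_distSq hsmooth))).mul
      (smooth_gradNormSq hΩ hsmooth)
  have hmain := heatOp_weighted_gradient_le (τ := ((1, 0) : ℝ × Eucl n)) (e := spaceDir)
    (g := F) (G := G) (L := L) (ε := 1 / (144 * (n : ℝ) ^ 9 * L)) hΩ hsmooth hGs
    (fun q hq => Matrix.nonsing_inv_mul _ (hdet q hq).isUnit)
    (fun q hq a b => by
      have := (hmetric q.1 hq.1 q.2 hq.2).1.inv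
      exact (this.apply a b).symm)
    (fun q hq i j => by
      obtain ⟨s, y⟩ := q
      have h1 := heq s hq.1 y hq.2 i j
      have hd : ∀ i j, DifferentiableAt ℝ (F i j) (s, y) := fun i j =>
        differentiableAt_of_smooth hΩ (hsmooth i j) hq
      have h2 := deriv_slice (hd i j)
      have h3 : ∀ a i j, pd a (fun z => g s z i j) y = dirD (spaceDir a) (F i j) (s, y) :=
        fun a i j => pd_slice (hd i j) a
      have h4 : ∀ a b, pd a (fun z => pd b (fun z' => g s z' i j) z) y
          = dirD (spaceDir a) (dirD (spaceDir b) (F i j)) (s, y) := fun a b =>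
        pd_pd_slice hI hU (hsmooth i j) hq.1 hq.2 a b
      simp only [h3, h4] at h1
      rw [heatOp, ← h2, sub_eq_iff_eq_add']
      exact h1)
    hL hn' (by positivity) (le_of_eq (by field_simp)) hp
    (by
      have h1 := hclose t ht x hx
      rw [Real.sqrt_le_left (by positivity)] at h1
      exact h1)
  have hderiv : deriv (fun s => (1 + L * matDistSq (g s x) 1) * gradSq g s x) t
      = dirD (1, 0) (fun q => (1 + L * distSq F q) * gradNormSq spaceDir F q) (t, x) := by
    rw [← deriv_slice (differentiableAt_of_smooth hΩ hω hp)]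
    apply Filter.EventuallyEq.deriv_eq
    filter_upwards [hI.mem_nhds ht] with s hs
    rw [hgrad s hs x hx]
    rfl
  have hspace : ∀ a b, pd a (fun y => pd b
        (fun z => (1 + L * matDistSq (g t z) 1) * gradSq g t z) y) x
      = dirD (spaceDir a) (dirD (spaceDir b)
        (fun q => (1 + L * distSq F q) * gradNormSq spaceDir F q)) (t, x) := fun a b => by
    rw [← pd_pd_slice hI hU hω ht hx]
    refine pd_congr hU (fun y hy => pd_congr hU (fun z hz => ?_) b hy) a hx
    simp only [hgrad t ht z hz]
    rfl
  rw [hderiv, hhess, hgrad t ht x hx]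
  simp only [hspace]
  rw [heatOp] at hmain
  linarith
end
end

section
/- W^{1,2+2σ} a priori estimate for the Ricci–DeTurck flow (flat-background case of Theorem 4.1 of the paper): There exists ε₀(n) > 0 such that for all 0 < r < ℓ there are constants c₁(n) > 0 and c₂(n,r,ℓ) > 0 with the following property. For every σ ∈ [0,1/4], every y₀ ∈ ℝⁿ, every T ∈ (0,1], and every Ricci–DeTurck flow g on B(y₀,4ℓ) over [0,T] satisfying |g(t,x) − δ| ≤ ε₀(n) for all (t,x), one has for all t ∈ [0,T]: ∫_{B(y₀,r)} |∂g(t)|^{2+2σ} dx + ∫_0^t ∫_{B(y₀,r)} ( |∂g(s)|^{4+2σ} + |∂g(s)|^{2σ} |∂²g(s)|² ) dx ds ≤ c₁(n) ∫_{B(y₀,ℓ)} |∂g(0)|^{2+2σ} dx + c₂(n,r,ℓ) · t · (1 + ∫_{B(y₀,ℓ)} |∂g(0)|² dx). -/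
open MeasureTheory Metric Set Filter Topology

noncomputable section

section Calculus

variable {n : ℕ} {U B : Set (Eucl n)} {f h : Eucl n → ℝ} {x : Eucl n} {a b : Fin n}

lemma pd_contDiffOn (hU : IsOpen U) (hf : ContDiffOn ℝ (⊤ : ℕ∞) f U) (a : Fin n) :
    ContDiffOn ℝ (⊤ : ℕ∞) (pd a f) U :=
  (hf.fderiv_of_isOpen hU (by simp)).clm_apply contDiffOn_const

lemma ContDiffOn.differentiableAt_of_isOpen (hf : ContDiffOn ℝ (⊤ : ℕ∞) f U) (hU : IsOpen U)
    (hx : x ∈ U) : DifferentiableAt ℝ f x :=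
  (hf.contDiffAt (hU.mem_nhds hx)).differentiableAt (by simp)

lemma pd_congr (hfh : f =ᶠ[𝓝 x] h) : pd a f x = pd a h x := by
  simp only [pd, hfh.fderiv_eq]

lemma pd_congr_on (hU : IsOpen U) (hx : x ∈ U) (hfh : ∀ y ∈ U, f y = h y) :
    pd a f x = pd a h x :=
  pd_congr (Filter.eventually_of_mem (hU.mem_nhds hx) hfh)

lemma pd_add (hf : DifferentiableAt ℝ f x) (hh : DifferentiableAt ℝ h x) :
    pd a (fun y => f y + h y) x = pd a f x + pd a h x := by
  simp only [pd, fderiv_fun_add hf hh, add_apply]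

lemma pd_add_const (c : ℝ) : pd a (fun y => f y + c) x = pd a f x := by
  simp only [pd, fderiv_add_const]

lemma pd_mul (hf : DifferentiableAt ℝ f x) (hh : DifferentiableAt ℝ h x) :
    pd a (fun y => f y * h y) x = pd a f x * h x + f x * pd a h x := by
  simp only [pd, fderiv_fun_mul hf hh, add_apply,
    smul_apply, smul_eq_mul]
  ring

lemma pd_sum {ι : Type*} [Fintype ι] {F : ι → Eucl n → ℝ}
    (hF : ∀ i, DifferentiableAt ℝ (F i) x) :
    pd a (fun y => ∑ i, F i y) x = ∑ i, pd a (F i) x := by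
  simp only [pd]
  rw [fderiv_fun_sum fun i _ => hF i, sum_apply]

lemma pd_pow (hf : DifferentiableAt ℝ f x) (m : ℕ) :
    pd a (fun y => f y ^ m) x = m * f x ^ (m - 1) * pd a f x := by
  simp only [pd, (hf.hasFDerivAt.pow m).fderiv, smul_apply, smul_eq_mul,
    nsmul_eq_mul]

lemma pd_rpow (hf : DifferentiableAt ℝ f x) (h0 : f x ≠ 0) (τ : ℝ) :
    pd a (fun y => f y ^ τ) x = τ * f x ^ (τ - 1) * pd a f x := by
  simp only [pd, (hf.hasFDerivAt.rpow_const (Or.inl h0)).fderiv,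
    smul_apply, smul_eq_mul]

lemma fderiv_apply_comm {F : Type*} [NormedAddCommGroup F] [NormedSpace ℝ F] {f : F → ℝ} {x : F}
    (hf : ContDiffAt ℝ (⊤ : ℕ∞) f x) (v w : F) :
    fderiv ℝ (fun y => fderiv ℝ f y v) x w = fderiv ℝ (fun y => fderiv ℝ f y w) x v := by
  have hd : DifferentiableAt ℝ (fderiv ℝ f) x :=
    (hf.fderiv_right (m := 1) (by norm_cast)).differentiableAt (by simp)
  have key : ∀ u : F, fderiv ℝ (fun y => fderiv ℝ f y u) x
      = (fderiv ℝ (fderiv ℝ f) x).flip u := fun u => by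
    have := (hd.hasFDerivAt.clm_apply (hasFDerivAt_const u x)).fderiv
    simpa using this
  rw [key, key]
  exact hf.isSymmSndFDerivAt (by simp; norm_cast) w v

lemma pd_comm (hU : IsOpen U) (hf : ContDiffOn ℝ (⊤ : ℕ∞) f U) (hx : x ∈ U) (a b : Fin n) :
    pd a (pd b f) x = pd b (pd a f) x :=
  fderiv_apply_comm (hf.contDiffAt (hU.mem_nhds hx)) _ _

lemma ContinuousOn.integrableOn_of_closure (hf : ContinuousOn f U) (hB : IsCompact (closure B))
    (hBU : closure B ⊆ U) : IntegrableOn f B :=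
  ((hf.mono hBU).integrableOn_compact hB).mono_set subset_closure

/-- Integration by parts against a cutoff function supported in a relatively compact set. -/
lemma setIntegral_mul_pd_eq_neg (hU : IsOpen U) (hB : IsCompact (closure B)) (hBU : closure B ⊆ U)
    {η P Q : Eucl n → ℝ} (hη : ContDiff ℝ (⊤ : ℕ∞) η)
    (hηB : tsupport η ⊆ B) (hP : ContDiffOn ℝ (⊤ : ℕ∞) P U) (hQ : ContDiffOn ℝ (⊤ : ℕ∞) Q U)
    (a : Fin n) :
    ∫ x in B, η x * P x * pd a Q x = -∫ x in B, pd a (fun y => η y * P y) x * Q x := by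
  set F : Eucl n → ℝ := fun y => η y * P y with hF
  have hFU : ContDiffOn ℝ (⊤ : ℕ∞) F U := hη.contDiffOn.mul hP
  have hFs : tsupport F ⊆ B := (tsupport_mul_subset_left).trans hηB
  have hF0 : ∀ x ∉ B, F x = 0 := fun x hx => image_eq_zero_of_notMem_tsupport fun h => hx (hFs h)
  have hdF0 : ∀ x ∉ B, pd a F x = 0 := fun x hx => by
    have : x ∉ tsupport (fderiv ℝ F) := fun h => hx (hFs (tsupport_fderiv_subset ℝ h))
    simp [pd, image_eq_zero_of_notMem_tsupport this]
  have hdiff : ∀ x, DifferentiableAt ℝ F x := fun x => by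
    by_cases hx : x ∈ U
    · exact hFU.differentiableAt_of_isOpen hU hx
    · have : x ∉ tsupport F := fun h => hx (hBU (subset_closure (hFs h)))
      exact ((notMem_tsupport_iff_eventuallyEq.1 this).differentiableAt_iff).2
        (differentiableAt_const _)
  have hint : ∀ G : Eucl n → ℝ, (∀ x ∉ B, G x = 0) → ContinuousOn G U → Integrable G :=
    fun G hG hc => (integrableOn_iff_integrable_of_support_subset fun x hx => by
      by_contra h; exact hx (hG x h)).1 (hc.integrableOn_of_closure hB hBU)
  rw [setIntegral_eq_integral_of_forall_compl_eq_zero (fun x hx => by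
      change F x * _ = 0; rw [hF0 x hx, zero_mul]),
    setIntegral_eq_integral_of_forall_compl_eq_zero (fun x hx => by rw [hdF0 x hx, zero_mul])]
  refine integral_mul_fderiv_eq_neg_fderiv_mul_of_integrable ?_ ?_ ?_ (fun x _ => hdiff x)
    fun x hx => hQ.differentiableAt_of_isOpen hU (hBU (subset_closure (hFs hx)))
  · exact hint _ (fun x hx => by change pd a F x * _ = 0; rw [hdF0 x hx, zero_mul])
      ((pd_contDiffOn hU hFU a).continuousOn.mul hQ.continuousOn)
  · exact hint _ (fun x hx => by change F x * _ = 0; rw [hF0 x hx, zero_mul])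
      (hFU.continuousOn.mul (pd_contDiffOn hU hQ a).continuousOn)
  · exact hint _ (fun x hx => by change F x * _ = 0; rw [hF0 x hx, zero_mul])
      (hFU.continuousOn.mul hQ.continuousOn)

end Calculus

section Weight

variable {n : ℕ} {ι : Type*} [Fintype ι]

/-- `|∂f|²` for a finite family of scalar functions. -/
def famGradSq (f : ι → Eucl n → ℝ) (x : Eucl n) : ℝ := ∑ a, ∑ i, (pd a (f i) x) ^ 2

/-- `|∂²f|²` for a finite family of scalar functions. -/
def famHessSq (f : ι → Eucl n → ℝ) (x : Eucl n) : ℝ :=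
  ∑ a, ∑ b, ∑ i, (pd a (pd b (f i)) x) ^ 2

/-- The regularised energy weight `|∂f|² + κ`. -/
def famWeight (f : ι → Eucl n → ℝ) (κ : ℝ) (x : Eucl n) : ℝ := famGradSq f x + κ

variable {U : Set (Eucl n)} {f : ι → Eucl n → ℝ} {κ : ℝ} {x : Eucl n}

lemma famGradSq_nonneg (f : ι → Eucl n → ℝ) (x : Eucl n) : 0 ≤ famGradSq f x := by
  unfold famGradSq; positivity

lemma famHessSq_nonneg (f : ι → Eucl n → ℝ) (x : Eucl n) : 0 ≤ famHessSq f x := by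
  unfold famHessSq; positivity

lemma famWeight_pos (hκ : 0 < κ) (f : ι → Eucl n → ℝ) (x : Eucl n) : 0 < famWeight f κ x :=
  add_pos_of_nonneg_of_pos (famGradSq_nonneg f x) hκ

lemma famGradSq_contDiffOn (hU : IsOpen U) (hf : ∀ i, ContDiffOn ℝ (⊤ : ℕ∞) (f i) U) :
    ContDiffOn ℝ (⊤ : ℕ∞) (famGradSq f) U :=
  ContDiffOn.sum fun a _ => ContDiffOn.sum fun i _ => (pd_contDiffOn hU (hf i) a).pow 2

lemma famHessSq_contDiffOn (hU : IsOpen U) (hf : ∀ i, ContDiffOn ℝ (⊤ : ℕ∞) (f i) U) :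
    ContDiffOn ℝ (⊤ : ℕ∞) (famHessSq f) U :=
  ContDiffOn.sum fun a _ => ContDiffOn.sum fun b _ => ContDiffOn.sum fun i _ =>
    (pd_contDiffOn hU (pd_contDiffOn hU (hf i) b) a).pow 2

lemma famWeight_rpow_contDiffOn (hU : IsOpen U) (hf : ∀ i, ContDiffOn ℝ (⊤ : ℕ∞) (f i) U)
    (hκ : 0 < κ) (τ : ℝ) : ContDiffOn ℝ (⊤ : ℕ∞) (fun y => famWeight f κ y ^ τ) U :=
  ((famGradSq_contDiffOn hU hf).add contDiffOn_const).rpow_const_of_ne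
    fun y _ => (famWeight_pos hκ f y).ne'

lemma pd_famWeight (hU : IsOpen U) (hf : ∀ i, ContDiffOn ℝ (⊤ : ℕ∞) (f i) U) (hx : x ∈ U)
    (k : Fin n) :
    pd k (famWeight f κ) x = 2 * ∑ a, ∑ i, pd a (f i) x * pd k (pd a (f i)) x := by
  have hd : ∀ a i, DifferentiableAt ℝ (pd a (f i)) x := fun a i =>
    (pd_contDiffOn hU (hf i) a).differentiableAt_of_isOpen hU hx
  have h1 : pd k (famWeight f κ) x = pd k (famGradSq f) x := pd_add_const κ
  have h2 : pd k (famGradSq f) x = ∑ a, ∑ i, pd k (fun y => pd a (f i) y ^ 2) x := by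
    have : famGradSq f = fun y => ∑ a, ∑ i, pd a (f i) y ^ 2 := rfl
    rw [this, pd_sum fun a => DifferentiableAt.fun_sum fun i _ => (hd a i).fun_pow 2]
    exact Finset.sum_congr rfl fun a _ => pd_sum fun i => (hd a i).fun_pow 2
  rw [h1, h2]
  simp only [Finset.mul_sum]
  refine Finset.sum_congr rfl fun a _ => Finset.sum_congr rfl fun i _ => ?_
  rw [pd_pow (hd a i)]
  norm_num
  ring

lemma sq_pd_le_famGradSq (f : ι → Eucl n → ℝ) (x : Eucl n) (a : Fin n) (i : ι) :
    pd a (f i) x ^ 2 ≤ famGradSq f x :=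
  (Finset.single_le_sum (f := fun i => pd a (f i) x ^ 2) (fun _ _ => sq_nonneg _)
    (Finset.mem_univ i)).trans
  (Finset.single_le_sum (f := fun a => ∑ i, pd a (f i) x ^ 2)
    (fun _ _ => Finset.sum_nonneg fun _ _ => sq_nonneg _) (Finset.mem_univ a))

lemma sum_sq_pd_pd_le_famHessSq (f : ι → Eucl n → ℝ) (x : Eucl n) (a : Fin n) :
    ∑ b, ∑ i, pd a (pd b (f i)) x ^ 2 ≤ famHessSq f x :=
  Finset.single_le_sum (f := fun a => ∑ b, ∑ i, pd a (pd b (f i)) x ^ 2)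
    (fun _ _ => Finset.sum_nonneg fun _ _ => Finset.sum_nonneg fun _ _ => sq_nonneg _)
    (Finset.mem_univ a)

lemma sq_pd_pd_le_famHessSq (f : ι → Eucl n → ℝ) (x : Eucl n) (a b : Fin n) (i : ι) :
    pd a (pd b (f i)) x ^ 2 ≤ famHessSq f x :=
  ((Finset.single_le_sum (f := fun i => pd a (pd b (f i)) x ^ 2) (fun _ _ => sq_nonneg _)
    (Finset.mem_univ i)).trans
  (Finset.single_le_sum (f := fun b => ∑ i, pd a (pd b (f i)) x ^ 2)
    (fun _ _ => Finset.sum_nonneg fun _ _ => sq_nonneg _) (Finset.mem_univ b))).trans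
  (sum_sq_pd_pd_le_famHessSq f x a)

lemma abs_pd_famWeight_le (hU : IsOpen U) (hf : ∀ i, ContDiffOn ℝ (⊤ : ℕ∞) (f i) U) (hκ : 0 ≤ κ)
    (hx : x ∈ U) (k : Fin n) :
    |pd k (famWeight f κ) x| ≤ 2 * √(famWeight f κ x) * √(famHessSq f x) := by
  rw [pd_famWeight hU hf hx, abs_mul, abs_two, mul_assoc, ← Real.sqrt_mul' _ (famHessSq_nonneg f x)]
  gcongr
  refine Real.abs_le_sqrt ?_
  rw [← Fintype.sum_prod_type']
  refine (Finset.sum_mul_sq_le_sq_mul_sq _ _ _).trans ?_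
  rw [Fintype.sum_prod_type, Fintype.sum_prod_type]
  have h1 : ∑ a, ∑ i, pd a (f i) x ^ 2 ≤ famWeight f κ x := le_add_of_nonneg_right hκ
  exact mul_le_mul h1 (sum_sq_pd_pd_le_famHessSq f x k) (by positivity)
    ((Finset.sum_nonneg fun _ _ => Finset.sum_nonneg fun _ _ => sq_nonneg _).trans h1)

variable {φ : Eucl n → ℝ}

lemma pd_cutoff_weight (hU : IsOpen U) (hf : ∀ i, ContDiffOn ℝ (⊤ : ℕ∞) (f i) U) (hκ : 0 < κ)
    (hφ : ContDiff ℝ (⊤ : ℕ∞) φ) (hx : x ∈ U) (τ : ℝ) (k m : Fin n) (i : ι) :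
    pd k (fun y => φ y ^ 6 * (famWeight f κ y ^ τ * pd m (f i) y)) x =
      6 * φ x ^ 5 * pd k φ x * (famWeight f κ x ^ τ * pd m (f i) x) +
      φ x ^ 6 * famWeight f κ x ^ τ * (τ / famWeight f κ x * pd k (famWeight f κ) x * pd m (f i) x
        + pd k (pd m (f i)) x) := by
  have hv := famWeight_pos hκ f x
  have dφ : DifferentiableAt ℝ φ x := hφ.differentiable (by simp) x
  have dw : DifferentiableAt ℝ (pd m (f i)) x :=
    (pd_contDiffOn hU (hf i) m).differentiableAt_of_isOpen hU hx
  have dv : DifferentiableAt ℝ (famWeight f κ) x :=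
    ((famGradSq_contDiffOn hU hf).differentiableAt_of_isOpen hU hx).add_const κ
  have dvt : DifferentiableAt ℝ (fun y => famWeight f κ y ^ τ) x :=
    (famWeight_rpow_contDiffOn hU hf hκ τ).differentiableAt_of_isOpen hU hx
  rw [pd_mul (dφ.fun_pow 6) (dvt.fun_mul dw), pd_pow dφ, pd_mul dvt dw, pd_rpow dv hv.ne',
    Real.rpow_sub_one hv.ne']
  norm_num
  field_simp

lemma abs_pd_cutoff_weight_le (hU : IsOpen U) (hf : ∀ i, ContDiffOn ℝ (⊤ : ℕ∞) (f i) U)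
    (hκ : 0 < κ) (hφ : ContDiff ℝ (⊤ : ℕ∞) φ) (hx : x ∈ U) {τ M : ℝ} (hτ0 : 0 ≤ τ)
    (hτ : τ ≤ 3 / 2) (hφ0 : 0 ≤ φ x) {k : Fin n} (hM : |pd k φ x| ≤ M) (m : Fin n) (i : ι) :
    |pd k (fun y => φ y ^ 6 * (famWeight f κ y ^ τ * pd m (f i) y)) x| ≤
      φ x ^ 5 * famWeight f κ x ^ τ *
        (6 * M * √(famWeight f κ x) + 4 * (φ x * √(famHessSq f x))) := by
  rw [pd_cutoff_weight hU hf hκ hφ hx]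
  have hv := famWeight_pos hκ f x
  have hdv := abs_pd_famWeight_le hU hf hκ.le hx k
  have hw : |pd m (f i) x| ≤ √(famWeight f κ x) :=
    Real.abs_le_sqrt ((sq_pd_le_famGradSq f x m i).trans (le_add_of_nonneg_right hκ.le))
  have hW : |pd k (pd m (f i)) x| ≤ √(famHessSq f x) :=
    Real.abs_le_sqrt (sq_pd_pd_le_famHessSq f x k m i)
  have hvt : 0 < famWeight f κ x ^ τ := Real.rpow_pos_of_pos hv τ
  have hsq := Real.mul_self_sqrt hv.le
  have hp : 0 < √(famWeight f κ x) := Real.sqrt_pos.2 hv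
  set v := famWeight f κ x
  set p := √v
  set h := √(famHessSq f x)
  have hh : 0 ≤ h := Real.sqrt_nonneg _
  have hM0 : 0 ≤ M := (abs_nonneg _).trans hM
  have e1 : |τ / v * pd k (famWeight f κ) x * pd m (f i) x| ≤ 3 * h := by
    rw [abs_mul, abs_mul, abs_of_nonneg (div_nonneg hτ0 hv.le)]
    calc τ / v * |pd k (famWeight f κ) x| * |pd m (f i) x|
        ≤ (3 / 2) / v * (2 * p * h) * p := by gcongr
      _ = 3 * h := by rw [← hsq]; field_simp
  calc _ ≤ |6 * φ x ^ 5 * pd k φ x * (v ^ τ * pd m (f i) x)| + |φ x ^ 6 * v ^ τ *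
        (τ / v * pd k (famWeight f κ) x * pd m (f i) x + pd k (pd m (f i)) x)| := abs_add_le _ _
    _ = 6 * φ x ^ 5 * |pd k φ x| * (v ^ τ * |pd m (f i) x|) + φ x ^ 6 * v ^ τ *
        |τ / v * pd k (famWeight f κ) x * pd m (f i) x + pd k (pd m (f i)) x| := by
      simp only [abs_mul, abs_of_pos hvt, abs_pow, abs_of_nonneg hφ0]; norm_num
    _ ≤ 6 * φ x ^ 5 * M * (v ^ τ * p) + φ x ^ 6 * v ^ τ * (3 * h + h) := by
      gcongr
      exact (abs_add_le _ _).trans (add_le_add e1 hW)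
    _ = _ := by ring

lemma sum_pd_cutoff_weight_mul_ge (hU : IsOpen U) (hf : ∀ i, ContDiffOn ℝ (⊤ : ℕ∞) (f i) U)
    (hκ : 0 < κ) (hφ : ContDiff ℝ (⊤ : ℕ∞) φ) (hx : x ∈ U) {τ M : ℝ} (hτ0 : 0 ≤ τ)
    (hφ0 : 0 ≤ φ x) (hM : ∀ k, |pd k φ x| ≤ M) :
    φ x ^ 6 * famWeight f κ x ^ τ * famHessSq f x -
      6 * n * M * φ x ^ 5 * famWeight f κ x ^ τ * (√(famWeight f κ x) * √(famHessSq f x)) ≤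
    ∑ k, ∑ m, ∑ i, pd k (fun y => φ y ^ 6 * (famWeight f κ y ^ τ * pd m (f i) y)) x *
      pd k (pd m (f i)) x := by
  have hv := famWeight_pos hκ f x
  have hvt : 0 < famWeight f κ x ^ τ := Real.rpow_pos_of_pos hv τ
  have key : ∀ k, ∑ m, ∑ i, pd k (fun y => φ y ^ 6 * (famWeight f κ y ^ τ * pd m (f i) y)) x *
      pd k (pd m (f i)) x = 3 * φ x ^ 5 * pd k φ x * famWeight f κ x ^ τ * pd k (famWeight f κ) x
      + φ x ^ 6 * famWeight f κ x ^ τ * (τ / famWeight f κ x) * pd k (famWeight f κ) x ^ 2 / 2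
      + φ x ^ 6 * famWeight f κ x ^ τ * ∑ m, ∑ i, pd k (pd m (f i)) x ^ 2 := fun k => by
    have h2 : ∑ m, ∑ i, pd m (f i) x * pd k (pd m (f i)) x = pd k (famWeight f κ) x / 2 := by
      rw [pd_famWeight hU hf hx]; ring
    calc _ = ∑ m, ∑ i, ((6 * φ x ^ 5 * pd k φ x * famWeight f κ x ^ τ + φ x ^ 6 *
          famWeight f κ x ^ τ * (τ / famWeight f κ x) * pd k (famWeight f κ) x) *
            (pd m (f i) x * pd k (pd m (f i)) x) +
          φ x ^ 6 * famWeight f κ x ^ τ * pd k (pd m (f i)) x ^ 2) := by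
          refine Finset.sum_congr rfl fun m _ => Finset.sum_congr rfl fun i _ => ?_
          rw [pd_cutoff_weight hU hf hκ hφ hx]
          ring
      _ = _ := by
          simp only [Finset.sum_add_distrib, ← Finset.mul_sum]
          rw [h2]
          ring
  have low : ∀ k, -(6 * M * φ x ^ 5 * famWeight f κ x ^ τ *
        (√(famWeight f κ x) * √(famHessSq f x)))
      + φ x ^ 6 * famWeight f κ x ^ τ * ∑ m, ∑ i, pd k (pd m (f i)) x ^ 2 ≤
      ∑ m, ∑ i, pd k (fun y => φ y ^ 6 * (famWeight f κ y ^ τ * pd m (f i) y)) x *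
      pd k (pd m (f i)) x := fun k => by
    rw [key]
    have hM0 : 0 ≤ M := (abs_nonneg _).trans (hM k)
    have h1 : |pd k φ x * pd k (famWeight f κ) x| ≤
        M * (2 * √(famWeight f κ x) * √(famHessSq f x)) := by
      rw [abs_mul]
      exact mul_le_mul (hM k) (abs_pd_famWeight_le hU hf hκ.le hx k) (abs_nonneg _) hM0
    have h2 := (abs_le.1 h1).1
    have h3 : 0 ≤ 3 * φ x ^ 5 * famWeight f κ x ^ τ := by positivity
    have h4 : 0 ≤ φ x ^ 6 * famWeight f κ x ^ τ * (τ / famWeight f κ x) *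
      pd k (famWeight f κ) x ^ 2 / 2 := by positivity
    nlinarith [mul_le_mul_of_nonneg_left h2 h3]
  refine le_trans (le_of_eq ?_) (Finset.sum_le_sum fun k _ => low k)
  rw [Finset.sum_add_distrib, ← Finset.mul_sum, Finset.sum_const, Finset.card_univ,
    Fintype.card_fin, nsmul_eq_mul]
  unfold famHessSq
  ring

end Weight

section StaticEnergy

/-- The coefficient of the interpolation inequality added to the energy inequality. -/
def interpCoeff (b : ℝ) : ℝ := 33 * b ^ 2 + 1

/-- The constant absorbing the cutoff errors. -/
def cutoffCoeff (d b M : ℝ) : ℝ :=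
  2 * (6 * d * M + 6 * M * b) ^ 2 + 9 * M ^ 2 + 2 * (6 * M / 16) ^ 2 + interpCoeff b

/-- The constant in front of the volume in the static energy inequality. -/
def volumeCoeff (c : ℝ) : ℝ := c * (4 * c + 16 * c ^ 2)

lemma interpCoeff_pos (b : ℝ) : 0 < interpCoeff b := by unfold interpCoeff; positivity

lemma cutoffCoeff_pos (d b M : ℝ) : 0 < cutoffCoeff d b M := by
  have := interpCoeff_pos b
  unfold cutoffCoeff; positivity

lemma volumeCoeff_nonneg {c : ℝ} (hc : 0 ≤ c) : 0 ≤ volumeCoeff c := by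
  unfold volumeCoeff; positivity

lemma quadratic_absorption {d b N M ε X Y Z : ℝ} (hb : 0 ≤ b) (hM : 0 ≤ M) (hε1 : ε ≤ 1)
    (hεb : 4 * b * ε ≤ 1 / 8) (hεN : 4 * ε * N * interpCoeff b ≤ 1 / 4) (hX : 0 ≤ X)
    (hY : 0 ≤ Y) (hZ : 0 ≤ Z) :
    -X ^ 2 + 6 * d * M * (X * Z) + b * ((6 * M * Z + 4 * X) * (ε * X + Y))
      + interpCoeff b * (ε * N * (Y * (6 * M * Z + 4 * X)) + Z ^ 2 - Y ^ 2)
      ≤ -X ^ 2 / 2 - Y ^ 2 / 2 + cutoffCoeff d b M * Z ^ 2 := by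
  have h1 : 4 * b * ε * X ^ 2 ≤ 1 / 8 * X ^ 2 := by gcongr
  have h2 : 4 * b * (X * Y) ≤ X ^ 2 / 8 + 32 * b ^ 2 * Y ^ 2 := by
    nlinarith [sq_nonneg (X - 16 * b * Y)]
  have h3 : 6 * M * b * ε * (X * Z) ≤ 6 * M * b * 1 * (X * Z) := by gcongr
  have h4 : (6 * d * M + 6 * M * b) * (X * Z) ≤
      X ^ 2 / 8 + 2 * (6 * d * M + 6 * M * b) ^ 2 * Z ^ 2 := by
    nlinarith [sq_nonneg (X - 4 * (6 * d * M + 6 * M * b) * Z)]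
  have h5 : 6 * M * b * (Z * Y) ≤ b ^ 2 * Y ^ 2 + 9 * M ^ 2 * Z ^ 2 := by
    nlinarith [sq_nonneg (b * Y - 3 * M * Z)]
  have h6 : 4 * ε * N * interpCoeff b * (X * Y) ≤ 1 / 4 * (X * Y) := by gcongr
  have h7 : 4 * ε * N * interpCoeff b * (6 * M / 4 * (Y * Z)) ≤ 1 / 4 * (6 * M / 4 * (Y * Z)) := by
    gcongr
  have h8 : 6 * M / 16 * (Y * Z) ≤ Y ^ 2 / 8 + 2 * (6 * M / 16) ^ 2 * Z ^ 2 := by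
    nlinarith [sq_nonneg (Y - 4 * (6 * M / 16) * Z)]
  have h9 : X * Y ≤ X ^ 2 / 2 + Y ^ 2 / 2 := by nlinarith [sq_nonneg (X - Y)]
  have h10 : interpCoeff b * Y ^ 2 = 33 * b ^ 2 * Y ^ 2 + Y ^ 2 := by unfold interpCoeff; ring
  unfold cutoffCoeff
  nlinarith [sq_nonneg Y]

lemma cutoff_pow_mul_rpow_le {s v φ c : ℝ} (hφ0 : 0 ≤ φ) (hφ1 : φ ≤ 1) (hv : 0 < v)
    (hs0 : 0 ≤ s) (hs : s ≤ 1 + v) (hc : 0 < c) :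
    c * (φ ^ 4 * s * v) ≤ φ ^ 4 * s * (φ * v) ^ 2 / 4 + volumeCoeff c := by
  unfold volumeCoeff
  by_cases h : 4 * c ≤ φ ^ 2 * v
  · have := mul_le_mul_of_nonneg_left h (by positivity : 0 ≤ φ ^ 4 * s * v)
    have : 0 < c * (4 * c + 16 * c ^ 2) := by positivity
    nlinarith
  · push Not at h
    have h1 : φ ^ 4 * s * v ≤ φ ^ 4 * (1 + v) * v := by gcongr
    have h2 : φ ^ 4 * v ≤ φ ^ 2 * v := by
      have : φ ^ 4 ≤ φ ^ 2 := pow_le_pow_of_le_one hφ0 hφ1 (by norm_num)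
      gcongr
    have h3 : (φ ^ 2 * v) ^ 2 ≤ (4 * c) ^ 2 := by gcongr
    have h4 : φ ^ 4 * s * v ≤ 4 * c + 16 * c ^ 2 := by nlinarith
    have := mul_le_mul_of_nonneg_left h4 hc.le
    have : 0 ≤ φ ^ 4 * s * (φ * v) ^ 2 / 4 := by positivity
    linarith

variable {n : ℕ} {ι : Type*} [Fintype ι] {U B : Set (Eucl n)} {f D : ι → Eucl n → ℝ}
  {φ : Eucl n → ℝ} {κ σ : ℝ}

lemma rpow_le_one_add {v τ : ℝ} (hv : 0 < v) (h0 : 0 ≤ τ) (h1 : τ ≤ 1) : v ^ τ ≤ 1 + v := by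
  rcases le_total v 1 with h | h
  · exact (Real.rpow_le_one hv.le h h0).trans (by linarith)
  · exact (Real.rpow_le_rpow_of_exponent_le h h1).trans (by rw [Real.rpow_one]; linarith)

lemma tsupport_pow_subset {η : Eucl n → ℝ} (hη : tsupport η ⊆ B) :
    tsupport (fun y => η y ^ 6) ⊆ B := by
  refine (closure_mono fun x hx => ?_).trans hη
  simp only [Function.mem_support] at hx ⊢
  exact fun h => hx (by simp [h])

lemma energy_identity (hU : IsOpen U) (hB : IsCompact (closure B)) (hBU : closure B ⊆ U)
    (hf : ∀ i, ContDiffOn ℝ (⊤ : ℕ∞) (f i) U) (hD : ∀ i, ContDiffOn ℝ (⊤ : ℕ∞) (D i) U)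
    (hBm : MeasurableSet B)
    (hκ : 0 < κ) (hφ : ContDiff ℝ (⊤ : ℕ∞) φ) (hφB : tsupport φ ⊆ B) :
    ∫ x in B, ∑ m, ∑ i, φ x ^ 6 * (famWeight f κ x ^ σ * pd m (f i) x) * pd m (D i) x =
    -∫ x in B, ((∑ a, ∑ m, ∑ i, pd a (fun y => φ y ^ 6 * (famWeight f κ y ^ σ * pd m (f i) y)) x *
        pd a (pd m (f i)) x) +
      ∑ m, ∑ i, pd m (fun y => φ y ^ 6 * (famWeight f κ y ^ σ * pd m (f i) y)) x *
        (D i x - ∑ a, pd a (pd a (f i)) x)) := by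
  have hw : ∀ m i, ContDiffOn ℝ (⊤ : ℕ∞) (pd m (f i)) U := fun m i => pd_contDiffOn hU (hf i) m
  have hW : ∀ a m i, ContDiffOn ℝ (⊤ : ℕ∞) (pd a (pd m (f i))) U :=
    fun a m i => pd_contDiffOn hU (hw m i) a
  have hF : ∀ m i, ContDiffOn ℝ (⊤ : ℕ∞)
      (fun y => famWeight f κ y ^ σ * pd m (f i) y) U := fun m i =>
    (famWeight_rpow_contDiffOn hU hf hκ σ).mul (hw m i)
  have hφ6 : ContDiff ℝ (⊤ : ℕ∞) (fun y => φ y ^ 6) := hφ.pow 6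
  have hG : ∀ m i, ContDiffOn ℝ (⊤ : ℕ∞)
      (fun y => φ y ^ 6 * (famWeight f κ y ^ σ * pd m (f i) y)) U := fun m i =>
    hφ6.contDiffOn.mul (hF m i)
  have hP : ∀ i, ContDiffOn ℝ (⊤ : ℕ∞) (fun x => D i x - ∑ a, pd a (pd a (f i)) x) U := fun i =>
    (hD i).sub (ContDiffOn.sum fun a _ => hW a a i)
  have hint : ∀ {h : Eucl n → ℝ}, ContDiffOn ℝ (⊤ : ℕ∞) h U → IntegrableOn h B := fun hh =>
    hh.continuousOn.integrableOn_of_closure hB hBU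
  have i1 : ∀ a m i, IntegrableOn (fun x =>
      pd a (fun y => φ y ^ 6 * (famWeight f κ y ^ σ * pd m (f i) y)) x *
        pd a (pd m (f i)) x) B := fun a m i => hint ((pd_contDiffOn hU (hG m i) a).mul (hW a m i))
  have i2 : ∀ m i, IntegrableOn (fun x =>
      pd m (fun y => φ y ^ 6 * (famWeight f κ y ^ σ * pd m (f i) y)) x *
        (D i x - ∑ a, pd a (pd a (f i)) x)) B := fun m i =>
    hint ((pd_contDiffOn hU (hG m i) m).mul (hP i))
  have key : ∀ m i, ∫ x in B, φ x ^ 6 * (famWeight f κ x ^ σ * pd m (f i) x) * pd m (D i) x =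
      -((∑ a, ∫ x in B, pd a (fun y => φ y ^ 6 * (famWeight f κ y ^ σ * pd m (f i) y)) x *
        pd a (pd m (f i)) x) + ∫ x in B, pd m (fun y => φ y ^ 6 *
          (famWeight f κ y ^ σ * pd m (f i) y)) x * (D i x - ∑ a, pd a (pd a (f i)) x)) := by
    intro m i
    have hsplit : ∀ x ∈ B, φ x ^ 6 * (famWeight f κ x ^ σ * pd m (f i) x) * pd m (D i) x =
        (∑ a, φ x ^ 6 * (famWeight f κ x ^ σ * pd m (f i) x) * pd a (pd a (pd m (f i))) x) +
        φ x ^ 6 * (famWeight f κ x ^ σ * pd m (f i) x) *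
          pd m (fun x => D i x - ∑ a, pd a (pd a (f i)) x) x := by
      intro x hx
      have hxU := hBU (subset_closure hx)
      have e : pd m (D i) x = pd m (fun x => D i x - ∑ a, pd a (pd a (f i)) x) x +
          ∑ a, pd m (pd a (pd a (f i))) x := by
        rw [← pd_sum fun a => (hW a a i).differentiableAt_of_isOpen hU hxU,
          ← pd_add ((hP i).differentiableAt_of_isOpen hU hxU)
            ((ContDiffOn.sum fun a _ => hW a a i).differentiableAt_of_isOpen hU hxU)]
        congr 1
        ext y
        ring
      have e2 : ∀ a, pd m (pd a (pd a (f i))) x = pd a (pd a (pd m (f i))) x := fun a => by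
        rw [pd_comm hU (hw a i) hxU m a]
        exact pd_congr_on hU hxU fun y hy => pd_comm hU (hf i) hy m a
      simp only [e, e2, ← Finset.mul_sum]
      ring
    rw [setIntegral_congr_fun hBm hsplit, integral_add, integral_finsetSum]
    · rw [setIntegral_mul_pd_eq_neg hU hB hBU hφ6 (tsupport_pow_subset hφB) (hF m i) (hP i),
        Finset.sum_congr rfl fun a _ => setIntegral_mul_pd_eq_neg hU hB hBU hφ6
          (tsupport_pow_subset hφB) (hF m i) (hW a m i) a, Finset.sum_neg_distrib]
      ring
    · exact fun a _ => hint ((hG m i).mul (pd_contDiffOn hU (hW a m i) a))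
    · exact hint (ContDiffOn.sum fun a _ => (hG m i).mul (pd_contDiffOn hU (hW a m i) a))
    · exact hint ((hG m i).mul (pd_contDiffOn hU (hP i) m))
  have i3 : ∀ m i, IntegrableOn (fun x =>
      φ x ^ 6 * (famWeight f κ x ^ σ * pd m (f i) x) * pd m (D i) x) B := fun m i =>
    hint ((hG m i).mul (pd_contDiffOn hU (hD i) m))
  rw [integral_add (integrable_finsetSum _ fun a _ => integrable_finsetSum _ fun m _ =>
      integrable_finsetSum _ fun i _ => i1 a m i)
    (integrable_finsetSum _ fun m _ => integrable_finsetSum _ fun i _ => i2 m i),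
    integral_finsetSum _ fun a _ => integrable_finsetSum _ fun m _ =>
      integrable_finsetSum _ fun i _ => i1 a m i,
    integral_finsetSum _ fun m _ => integrable_finsetSum _ fun i _ => i2 m i,
    integral_finsetSum _ fun m _ => integrable_finsetSum _ fun i _ => i3 m i,
    Finset.sum_congr rfl fun m _ => integral_finsetSum _ fun i _ => i3 m i,
    Finset.sum_congr rfl fun m _ => integral_finsetSum _ fun i _ => i2 m i,
    Finset.sum_congr rfl fun a _ => integral_finsetSum _ fun m _ =>
      integrable_finsetSum _ fun i _ => i1 a m i,
    Finset.sum_congr rfl fun a _ => Finset.sum_congr rfl fun m _ =>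
      integral_finsetSum _ fun i _ => i1 a m i]
  simp only [key, Finset.sum_neg_distrib, Finset.sum_add_distrib]
  congr 2
  rw [Finset.sum_comm]
  conv_lhs => enter [2, i]; rw [Finset.sum_comm]
  rw [Finset.sum_comm]
  exact Finset.sum_congr rfl fun a _ => Finset.sum_comm

lemma interpolation_identity (hU : IsOpen U) (hB : IsCompact (closure B)) (hBU : closure B ⊆ U)
    (hf : ∀ i, ContDiffOn ℝ (⊤ : ℕ∞) (f i) U) (hBm : MeasurableSet B)
    (hκ : 0 < κ) (hφ : ContDiff ℝ (⊤ : ℕ∞) φ) (hφB : tsupport φ ⊆ B) (τ : ℝ) (c : ι → ℝ) :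
    ∫ x in B, φ x ^ 6 * famWeight f κ x ^ τ * famGradSq f x =
    -∫ x in B, ∑ m, ∑ i, pd m (fun y => φ y ^ 6 * (famWeight f κ y ^ τ * pd m (f i) y)) x *
        (f i x + c i) := by
  have hw : ∀ m i, ContDiffOn ℝ (⊤ : ℕ∞) (pd m (f i)) U := fun m i => pd_contDiffOn hU (hf i) m
  have hF : ∀ m i, ContDiffOn ℝ (⊤ : ℕ∞)
      (fun y => famWeight f κ y ^ τ * pd m (f i) y) U := fun m i =>
    (famWeight_rpow_contDiffOn hU hf hκ τ).mul (hw m i)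
  have hφ6 : ContDiff ℝ (⊤ : ℕ∞) (fun y => φ y ^ 6) := hφ.pow 6
  have hG : ∀ m i, ContDiffOn ℝ (⊤ : ℕ∞)
      (fun y => φ y ^ 6 * (famWeight f κ y ^ τ * pd m (f i) y)) U := fun m i =>
    hφ6.contDiffOn.mul (hF m i)
  have hfc : ∀ i, ContDiffOn ℝ (⊤ : ℕ∞) (fun x => f i x + c i) U := fun i =>
    (hf i).add contDiffOn_const
  have hint : ∀ {h : Eucl n → ℝ}, ContDiffOn ℝ (⊤ : ℕ∞) h U → IntegrableOn h B := fun hh =>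
    hh.continuousOn.integrableOn_of_closure hB hBU
  have i1 : ∀ m i, IntegrableOn (fun x => φ x ^ 6 * (famWeight f κ x ^ τ * pd m (f i) x) *
      pd m (fun y => f i y + c i) x) B := fun m i =>
    hint ((hG m i).mul (pd_contDiffOn hU (hfc i) m))
  have i2 : ∀ m i, IntegrableOn (fun x =>
      pd m (fun y => φ y ^ 6 * (famWeight f κ y ^ τ * pd m (f i) y)) x * (f i x + c i)) B :=
    fun m i => hint ((pd_contDiffOn hU (hG m i) m).mul (hfc i))
  have e : ∀ x ∈ B, φ x ^ 6 * famWeight f κ x ^ τ * famGradSq f x =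
      ∑ m, ∑ i, φ x ^ 6 * (famWeight f κ x ^ τ * pd m (f i) x) *
        pd m (fun y => f i y + c i) x := fun x _ => by
    simp only [pd_add_const, famGradSq, Finset.mul_sum]
    exact Finset.sum_congr rfl fun m _ => Finset.sum_congr rfl fun i _ => by ring
  rw [setIntegral_congr_fun hBm e,
    integral_finsetSum _ fun m _ => integrable_finsetSum _ fun i _ => i1 m i,
    integral_finsetSum _ fun m _ => integrable_finsetSum _ fun i _ => i2 m i,
    Finset.sum_congr rfl fun m _ => integral_finsetSum _ fun i _ => i1 m i,
    Finset.sum_congr rfl fun m _ => integral_finsetSum _ fun i _ => i2 m i]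
  simp only [← Finset.sum_neg_distrib]
  exact Finset.sum_congr rfl fun m _ => Finset.sum_congr rfl fun i _ =>
    setIntegral_mul_pd_eq_neg hU hB hBU hφ6 (tsupport_pow_subset hφB) (hF m i) (hfc i) m

set_option maxHeartbeats 1000000 in
/-- Energy inequality for the regularised weight at a fixed time: if `D` is a small perturbation of
the Laplacian of `f` up to terms quadratic in `∂f`, and `f` is close to a constant, then the
variation of the localised energy in the direction `D` is coercive up to a volume term. -/
theorem static_energy_le (hU : IsOpen U) (hB : IsCompact (closure B)) (hBU : closure B ⊆ U)
    (hBm : MeasurableSet B)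
    (hf : ∀ i, ContDiffOn ℝ (⊤ : ℕ∞) (f i) U) (hD : ∀ i, ContDiffOn ℝ (⊤ : ℕ∞) (D i) U)
    (hκ : 0 < κ) (hκ1 : κ ≤ 1) (hφ : ContDiff ℝ (⊤ : ℕ∞) φ) (hφB : tsupport φ ⊆ B)
    (hφ0 : ∀ x, 0 ≤ φ x) (hφ1 : ∀ x, φ x ≤ 1) {M : ℝ} (hM0 : 0 ≤ M)
    (hM : ∀ x k, |pd k φ x| ≤ M) (hσ0 : 0 ≤ σ) (hσ1 : σ ≤ 1 / 4) {ε A : ℝ}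
    (hε1 : ε ≤ 1) (hA : 0 ≤ A) (hεb : 4 * (n * Fintype.card ι * A) * ε ≤ 1 / 8)
    (hεN : 4 * ε * (n * Fintype.card ι) * interpCoeff (n * Fintype.card ι * A) ≤ 1 / 4)
    {c : ι → ℝ} (hfc : ∀ x ∈ B, ∀ i, |f i x + c i| ≤ ε)
    (hDf : ∀ x ∈ B, ∀ i, |D i x - ∑ a, pd a (pd a (f i)) x| ≤
      A * (ε * √(famHessSq f x) + famGradSq f x)) :
    ∫ x in B, ∑ m, ∑ i, φ x ^ 6 * (famWeight f κ x ^ σ * pd m (f i) x) * pd m (D i) x ≤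
      -(1 / 4) * (∫ x in B, φ x ^ 6 * (famWeight f κ x ^ σ *
        (famHessSq f x + famWeight f κ x ^ 2))) +
      volumeCoeff (cutoffCoeff n (n * Fintype.card ι * A) M) * volume.real B := by
  set b : ℝ := n * Fintype.card ι * A with hb
  set N : ℝ := n * Fintype.card ι with hN
  have hb0 : 0 ≤ b := by positivity
  have hBfin : volume B ≠ ⊤ :=
    ((measure_mono subset_closure).trans_lt hB.measure_lt_top).ne
  have hw : ∀ m i, ContDiffOn ℝ (⊤ : ℕ∞) (pd m (f i)) U := fun m i => pd_contDiffOn hU (hf i) m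
  have hW : ∀ a m i, ContDiffOn ℝ (⊤ : ℕ∞) (pd a (pd m (f i))) U :=
    fun a m i => pd_contDiffOn hU (hw m i) a
  have hφ6 : ContDiff ℝ (⊤ : ℕ∞) (fun y => φ y ^ 6) := hφ.pow 6
  have hG : ∀ (τ : ℝ) m i, ContDiffOn ℝ (⊤ : ℕ∞)
      (fun y => φ y ^ 6 * (famWeight f κ y ^ τ * pd m (f i) y)) U := fun τ m i =>
    hφ6.contDiffOn.mul ((famWeight_rpow_contDiffOn hU hf hκ τ).mul (hw m i))
  have hint : ∀ {h : Eucl n → ℝ}, ContDiffOn ℝ (⊤ : ℕ∞) h U → IntegrableOn h B := fun hh =>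
    hh.continuousOn.integrableOn_of_closure hB hBU
  have hv2 : ContDiffOn ℝ (⊤ : ℕ∞) (famWeight f κ) U :=
    (famGradSq_contDiffOn hU hf).add contDiffOn_const
  set G₁ : Eucl n → ℝ := fun x =>
    (∑ a, ∑ m, ∑ i, pd a (fun y => φ y ^ 6 * (famWeight f κ y ^ σ * pd m (f i) y)) x *
        pd a (pd m (f i)) x) +
      ∑ m, ∑ i, pd m (fun y => φ y ^ 6 * (famWeight f κ y ^ σ * pd m (f i) y)) x *
        (D i x - ∑ a, pd a (pd a (f i)) x) with hG₁
  set G₂ : Eucl n → ℝ := fun x =>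
    ∑ m, ∑ i, pd m (fun y => φ y ^ 6 * (famWeight f κ y ^ (σ + 1) * pd m (f i) y)) x *
        (f i x + c i) with hG₂
  set R : Eucl n → ℝ := fun x => φ x ^ 6 * famWeight f κ x ^ (σ + 1) * famGradSq f x with hR
  set E : Eucl n → ℝ := fun x => φ x ^ 6 * (famWeight f κ x ^ σ *
        (famHessSq f x + famWeight f κ x ^ 2)) with hE
  have iG₁ : IntegrableOn G₁ B := hint <| by
    refine (ContDiffOn.sum fun a _ => ContDiffOn.sum fun m _ => ContDiffOn.sum fun i _ =>
      (pd_contDiffOn hU (hG σ m i) a).mul (hW a m i)).add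
      (ContDiffOn.sum fun m _ => ContDiffOn.sum fun i _ =>
        (pd_contDiffOn hU (hG σ m i) m).mul ((hD i).sub (ContDiffOn.sum fun a _ => hW a a i)))
  have iG₂ : IntegrableOn G₂ B := hint <|
    ContDiffOn.sum fun m _ => ContDiffOn.sum fun i _ =>
      (pd_contDiffOn hU (hG _ m i) m).mul ((hf i).add contDiffOn_const)
  have iR : IntegrableOn R B := hint <|
    (hφ6.contDiffOn.mul (famWeight_rpow_contDiffOn hU hf hκ _)).mul (famGradSq_contDiffOn hU hf)
  have iE : IntegrableOn E B := hint <|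
    hφ6.contDiffOn.mul ((famWeight_rpow_contDiffOn hU hf hκ _).mul
      ((famHessSq_contDiffOn hU hf).add (hv2.pow 2)))
  have e1 := energy_identity (σ := σ) hU hB hBU hf hD hBm hκ hφ hφB
  have e2 := interpolation_identity hU hB hBU hf hBm hκ hφ hφB (σ + 1) c
  change _ = -∫ x in B, G₁ x at e1
  change ∫ x in B, R x = -∫ x in B, G₂ x at e2
  set Λ := interpCoeff b with hΛ
  have hΛ0 : 0 < Λ := interpCoeff_pos b
  set V := volumeCoeff (cutoffCoeff n b M) with hV
  have pw : ∀ x ∈ B, -G₁ x - Λ * G₂ x - Λ * R x ≤ -(1 / 4) * E x + V := by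
    intro x hx
    have hxU : x ∈ U := hBU (subset_closure hx)
    have hv := famWeight_pos hκ f x
    have hH := famHessSq_nonneg f x
    have hs : 0 < famWeight f κ x ^ σ := Real.rpow_pos_of_pos hv σ
    have hs1 : famWeight f κ x ^ σ ≤ 1 + famWeight f κ x := rpow_le_one_add hv hσ0 (by linarith)
    have hτ : famWeight f κ x ^ (σ + 1) = famWeight f κ x ^ σ * famWeight f κ x :=
      Real.rpow_add_one hv.ne' σ
    have hφx := hφ0 x
    have hg1 := sum_pd_cutoff_weight_mul_ge hU hf hκ hφ hxU hσ0 hφx (hM x)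
    have hF := fun (τ : ℝ) (h0 : 0 ≤ τ) (h1 : τ ≤ 3 / 2) (m : Fin n) (i : ι) =>
      abs_pd_cutoff_weight_le hU hf hκ hφ hxU h0 h1 hφx (hM x m) m i
    have hP := hDf x hx
    have hC := hfc x hx
    have hgrad : famGradSq f x = famWeight f κ x - κ := by simp [famWeight]
    have hgv : famGradSq f x ≤ famWeight f κ x := by rw [hgrad]; linarith
    have hpp := Real.sq_sqrt hv.le
    have hhh := Real.sq_sqrt hH
    have hp0 := Real.sqrt_nonneg (famWeight f κ x)
    have hh0 := Real.sqrt_nonneg (famHessSq f x)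
    have hg2 : ∀ (Q : ι → ℝ) (q τ : ℝ), 0 ≤ τ → τ ≤ 3 / 2 → (∀ i, |Q i| ≤ q) →
        -(∑ m, ∑ i, pd m (fun y => φ y ^ 6 * (famWeight f κ y ^ τ * pd m (f i) y)) x * Q i) ≤
        N * (φ x ^ 5 * famWeight f κ x ^ τ *
        (6 * M * √(famWeight f κ x) + 4 * (φ x * √(famHessSq f x))) * q) := by
      intro Q q τ h0 h1 hQ
      rw [hN, ← Finset.sum_neg_distrib]
      have hq : ∀ i : ι, 0 ≤ q := fun i => (abs_nonneg _).trans (hQ i)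
      calc _ ≤ ∑ m : Fin n, ∑ i : ι, φ x ^ 5 * famWeight f κ x ^ τ *
            (6 * M * √(famWeight f κ x) + 4 * (φ x * √(famHessSq f x))) * q := by
            refine Finset.sum_le_sum fun m _ => ?_
            rw [← Finset.sum_neg_distrib]
            refine Finset.sum_le_sum fun i _ => (neg_le_abs _).trans ?_
            rw [abs_mul]
            exact mul_le_mul (hF τ h0 h1 m i) (hQ i) (abs_nonneg _)
              ((abs_nonneg _).trans (hF τ h0 h1 m i))
        _ = _ := by
            simp only [Finset.sum_const, Finset.card_univ, Fintype.card_fin, nsmul_eq_mul]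
            ring
    have hgA := hg2 _ _ σ hσ0 (by linarith) hP
    have hgB := hg2 _ _ (σ + 1) (by linarith) (by linarith) hC
    rw [hτ] at hgB
    simp only [hG₁, hG₂, hR, hE, hτ]
    set v := famWeight f κ x
    set s := v ^ σ
    set p := √v
    set h := √(famHessSq f x)
    have quad := quadratic_absorption (d := n) (X := φ x * h) (Y := φ x * v) (Z := p) hb0 hM0
      hε1 hεb hεN (by positivity) (by positivity) hp0
    have cut := cutoff_pow_mul_rpow_le hφx (hφ1 x) hv hs.le hs1 (cutoffCoeff_pos n b M)
    have hw4 : 0 ≤ φ x ^ 4 * s := by positivity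
    have quad' := mul_le_mul_of_nonneg_left quad hw4
    have hgA' : N * (φ x ^ 5 * s * (6 * M * p + 4 * (φ x * h)) *
        (A * (ε * h + famGradSq f x))) ≤
        φ x ^ 4 * s * (b * ((6 * M * p + 4 * (φ x * h)) * (ε * (φ x * h) + φ x * v))) := by
      calc _ ≤ N * (φ x ^ 5 * s * (6 * M * p + 4 * (φ x * h)) * (A * (ε * h + v))) := by gcongr
        _ = _ := by rw [hb]; ring
    have hκφ : κ * φ x ^ 2 ≤ 1 :=
      mul_le_one₀ hκ1 (by positivity) (pow_le_one₀ hφx (hφ1 x))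
    have hRlow : φ x ^ 4 * s * ((φ x * v) ^ 2 - v) ≤ φ x ^ 6 * (s * v) * famGradSq f x := by
      rw [hgrad]
      have : φ x ^ 4 * s * v * (κ * φ x ^ 2) ≤ φ x ^ 4 * s * v * 1 := by gcongr
      nlinarith
    have hRlow' := mul_le_mul_of_nonneg_left hRlow hΛ0.le
    have hgB' := mul_le_mul_of_nonneg_left hgB hΛ0.le
    have hE0 : 0 ≤ φ x ^ 4 * s * (φ x * h) ^ 2 := by positivity
    rw [hpp] at quad'
    have hEH : φ x ^ 6 * (s * (famHessSq f x + v ^ 2)) =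
        φ x ^ 4 * s * (φ x * h) ^ 2 + φ x ^ 4 * s * (φ x * v) ^ 2 := by
      rw [mul_pow, hhh]; ring
    have hg1' : φ x ^ 6 * s * famHessSq f x = φ x ^ 4 * s * (φ x * h) ^ 2 := by
      rw [mul_pow, hhh]; ring
    rw [hEH]
    rw [hg1'] at hg1
    have hY0 : 0 ≤ φ x ^ 4 * s * (φ x * v) ^ 2 := by positivity
    linarith
  have iN : IntegrableOn (fun x => -G₁ x) B := iG₁.neg
  have iS : IntegrableOn (fun x => -G₁ x - Λ * G₂ x) B := iN.sub (iG₂.const_mul Λ)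
  have hfin : ∫ x in B, (-G₁ x - Λ * G₂ x - Λ * R x) ≤ ∫ x in B, (-(1 / 4) * E x + V) :=
    setIntegral_mono_on (iS.sub (iR.const_mul Λ))
      ((iE.const_mul _).add (integrableOn_const hBfin)) hBm pw
  rw [integral_sub iS (iR.const_mul Λ),
    integral_sub iN (iG₂.const_mul Λ), integral_add (iE.const_mul _)
    (integrableOn_const hBfin), integral_neg, integral_const_mul, integral_const_mul,
    integral_const_mul, setIntegral_const, e2, smul_eq_mul] at hfin
  rw [e1]
  linarith

end StaticEnergy

section SpaceTime

variable {n : ℕ} {U B : Set (Eucl n)} {F : ℝ → Eucl n → ℝ} {I : Set ℝ} {T t : ℝ} {x : Eucl n}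

lemma ContDiffOn.slice (hF : ContDiffOn ℝ (⊤ : ℕ∞) (fun p : ℝ × Eucl n => F p.1 p.2) (I ×ˢ U))
    (ht : t ∈ I) : ContDiffOn ℝ (⊤ : ℕ∞) (F t) U :=
  hF.comp (f := fun y : Eucl n => (t, y)) (contDiff_prodMk_right t).contDiffOn
    fun _ hy => ⟨ht, hy⟩

lemma ContinuousOn.slice (hF : ContinuousOn (fun p : ℝ × Eucl n => F p.1 p.2) (I ×ˢ U))
    (ht : t ∈ I) : ContinuousOn (F t) U :=
  hF.comp (f := fun y : Eucl n => (t, y)) (by fun_prop) fun _ hy => ⟨ht, hy⟩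

/-- Spatial partial derivatives of a jointly smooth function are jointly smooth, up to the
boundary in time. -/
lemma pd_contDiffOn_prod (hU : IsOpen U) (hI : UniqueDiffOn ℝ I)
    (hF : ContDiffOn ℝ (⊤ : ℕ∞) (fun p : ℝ × Eucl n => F p.1 p.2) (I ×ˢ U)) (a : Fin n) :
    ContDiffOn ℝ (⊤ : ℕ∞) (fun p : ℝ × Eucl n => pd a (F p.1) p.2) (I ×ˢ U) := by
  have hS : UniqueDiffOn ℝ (I ×ˢ U) := hI.prod hU.uniqueDiffOn
  have h1 : ContDiffOn ℝ (⊤ : ℕ∞) (fun p => fderivWithin ℝ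
      (fun p : ℝ × Eucl n => F p.1 p.2) (I ×ˢ U) p
      ((0 : ℝ), (EuclideanSpace.single a (1 : ℝ) : Eucl n))) (I ×ˢ U) :=
    (hF.fderivWithin hS (by simp)).clm_apply contDiffOn_const
  refine h1.congr fun p hp => ?_
  obtain ⟨s, y⟩ := p
  obtain ⟨hs, hy⟩ : s ∈ I ∧ y ∈ U := hp
  have hd := ((hF.differentiableOn (by simp)) (s, y) ⟨hs, hy⟩).hasFDerivWithinAt
  have hc : HasFDerivWithinAt (fun z : Eucl n => (s, z)) (ContinuousLinearMap.inr ℝ ℝ (Eucl n))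
      U y :=
    (hasFDerivAt_prodMk_right s y).hasFDerivWithinAt
  have hcomp := (HasFDerivWithinAt.comp y hd hc fun z hz => ⟨hs, hz⟩).hasFDerivAt (hU.mem_nhds hy)
  have : fderiv ℝ (F s) y = _ := hcomp.fderiv
  simp only [pd, this]
  simp

lemma hasDerivAt_of_contDiffOn_prod (hI : IsOpen I) (hU : IsOpen U)
    (hF : ContDiffOn ℝ (⊤ : ℕ∞) (fun p : ℝ × Eucl n => F p.1 p.2) (I ×ˢ U)) (ht : t ∈ I)
    (hx : x ∈ U) :
    HasDerivAt (fun s => F s x)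
      (fderiv ℝ (fun p : ℝ × Eucl n => F p.1 p.2) (t, x) ((1 : ℝ), (0 : Eucl n))) t := by
  have hmem : I ×ˢ U ∈ 𝓝 (t, x) := (hI.prod hU).mem_nhds ⟨ht, hx⟩
  have hd := ((hF.contDiffAt hmem).differentiableAt (by simp)).hasFDerivAt
  have hc : HasDerivAt (fun s : ℝ => (s, x)) ((1 : ℝ), (0 : Eucl n)) t :=
    (hasDerivAt_id t).prodMk (hasDerivAt_const t x)
  exact HasFDerivAt.comp_hasDerivAt t hd hc

lemma pd_eq_fderiv_prod (hI : IsOpen I) (hU : IsOpen U)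
    (hF : ContDiffOn ℝ (⊤ : ℕ∞) (fun p : ℝ × Eucl n => F p.1 p.2) (I ×ˢ U)) (ht : t ∈ I)
    (hx : x ∈ U) (a : Fin n) :
    pd a (F t) x = fderiv ℝ (fun p : ℝ × Eucl n => F p.1 p.2) (t, x)
      ((0 : ℝ), (EuclideanSpace.single a (1 : ℝ) : Eucl n)) := by
  have hmem : I ×ˢ U ∈ 𝓝 (t, x) := (hI.prod hU).mem_nhds ⟨ht, hx⟩
  have hd := ((hF.contDiffAt hmem).differentiableAt (by simp)).hasFDerivAt
  have hcomp := HasFDerivAt.comp x hd (hasFDerivAt_prodMk_right t x)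
  have : fderiv ℝ (F t) x = _ := hcomp.fderiv
  simp only [pd, this]
  simp

lemma deriv_contDiffOn_prod (hI : IsOpen I) (hU : IsOpen U)
    (hF : ContDiffOn ℝ (⊤ : ℕ∞) (fun p : ℝ × Eucl n => F p.1 p.2) (I ×ˢ U)) :
    ContDiffOn ℝ (⊤ : ℕ∞) (fun p : ℝ × Eucl n => deriv (fun s => F s p.2) p.1) (I ×ˢ U) :=
  ((hF.fderiv_of_isOpen (hI.prod hU) (by simp)).clm_apply contDiffOn_const).congr
    fun p hp => (hasDerivAt_of_contDiffOn_prod (t := p.1) (x := p.2) hI hU hF hp.1 hp.2).deriv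

/-- Spatial and time derivatives commute. -/
lemma hasDerivAt_pd (hI : IsOpen I) (hU : IsOpen U)
    (hF : ContDiffOn ℝ (⊤ : ℕ∞) (fun p : ℝ × Eucl n => F p.1 p.2) (I ×ˢ U)) (ht : t ∈ I)
    (hx : x ∈ U) (a : Fin n) :
    HasDerivAt (fun s => pd a (F s) x) (pd a (fun y => deriv (fun s => F s y) t) x) t := by
  have hO := hI.prod hU
  have hmem : I ×ˢ U ∈ 𝓝 (t, x) := hO.mem_nhds ⟨ht, hx⟩
  have h1 := hasDerivAt_of_contDiffOn_prod (F := fun s => pd a (F s)) hI hU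
    (pd_contDiffOn_prod hU hI.uniqueDiffOn hF a) ht hx
  convert h1 using 1
  rw [pd_eq_fderiv_prod (F := fun s y => deriv (fun s => F s y) s) hI hU
    (deriv_contDiffOn_prod hI hU hF) ht hx a]
  have e1 : (fun p : ℝ × Eucl n => deriv (fun s => F s p.2) p.1) =ᶠ[𝓝 (t, x)] fun p =>
      fderiv ℝ (fun p : ℝ × Eucl n => F p.1 p.2) p ((1 : ℝ), (0 : Eucl n)) :=
    Filter.eventually_of_mem hmem fun p hp =>
      (hasDerivAt_of_contDiffOn_prod (t := p.1) (x := p.2) hI hU hF hp.1 hp.2).deriv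
  have e2 : (fun p : ℝ × Eucl n => pd a (F p.1) p.2) =ᶠ[𝓝 (t, x)] fun p =>
      fderiv ℝ (fun p : ℝ × Eucl n => F p.1 p.2) p
        ((0 : ℝ), (EuclideanSpace.single a (1 : ℝ) : Eucl n)) :=
    Filter.eventually_of_mem hmem fun p hp =>
      pd_eq_fderiv_prod (t := p.1) (x := p.2) hI hU hF hp.1 hp.2 a
  rw [e1.fderiv_eq, e2.fderiv_eq]
  exact fderiv_apply_comm (hF.contDiffAt hmem) _ _

lemma continuousOn_setIntegral (hB : IsCompact (closure B)) (hBU : closure B ⊆ U)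
    (hBm : MeasurableSet B) (hI : IsCompact I)
    (hF : ContinuousOn (fun p : ℝ × Eucl n => F p.1 p.2) (I ×ˢ U)) :
    ContinuousOn (fun s => ∫ x in B, F s x) I := by
  obtain ⟨C, hC⟩ := (hI.prod hB).exists_bound_of_continuousOn
    (hF.mono (prod_mono subset_rfl hBU))
  have hBfin : volume B ≠ ⊤ :=
    ((measure_mono subset_closure).trans_lt hB.measure_lt_top).ne
  refine MeasureTheory.continuousOn_of_dominated (F := F) (μ := volume.restrict B)
    (bound := fun _ => C) (fun s hs => ?_) (fun s hs => ?_)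
    (integrableOn_const hBfin) ?_
  · exact ((ContinuousOn.slice (F := F) hF hs).integrableOn_of_closure hB hBU).aestronglyMeasurable
  · exact (ae_restrict_mem hBm).mono fun x hx => hC (s, x) ⟨hs, subset_closure hx⟩
  · exact (ae_restrict_mem hBm).mono fun x hx =>
      ContinuousOn.comp (f := fun s : ℝ => (s, x)) hF (by fun_prop)
        fun s hs => ⟨hs, hBU (subset_closure hx)⟩

lemma hasDerivAt_setIntegral (hU : IsOpen U) (hB : IsCompact (closure B)) (hBU : closure B ⊆ U)
    (hBm : MeasurableSet B) (hI : IsOpen I)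
    (hF : ContDiffOn ℝ (⊤ : ℕ∞) (fun p : ℝ × Eucl n => F p.1 p.2) (I ×ˢ U)) (ht : t ∈ I) :
    HasDerivAt (fun s => ∫ x in B, F s x) (∫ x in B, deriv (fun s => F s x) t) t := by
  obtain ⟨δ, hδ, hδI⟩ := Metric.nhds_basis_closedBall.mem_iff.1 (hI.mem_nhds ht)
  have hF' := (deriv_contDiffOn_prod hI hU hF).continuousOn
  obtain ⟨C, hC⟩ := ((isCompact_closedBall t δ).prod hB).exists_bound_of_continuousOn
    (hF'.mono (prod_mono hδI hBU))
  have hBfin : volume B ≠ ⊤ :=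
    ((measure_mono subset_closure).trans_lt hB.measure_lt_top).ne
  refine (hasDerivAt_integral_of_dominated_loc_of_deriv_le (s := closedBall t δ) (F := F)
    (F' := fun s x => deriv (fun s => F s x) s) (bound := fun _ => C)
    (Metric.closedBall_mem_nhds t hδ) ?_ ?_ ?_ ?_
    (integrableOn_const hBfin) ?_).2
  · filter_upwards [hI.mem_nhds ht] with s hs
    exact ((ContDiffOn.slice (F := F) hF hs).continuousOn.integrableOn_of_closure
      hB hBU).aestronglyMeasurable
  · exact (ContDiffOn.slice (F := F) hF ht).continuousOn.integrableOn_of_closure hB hBU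
  · exact ((ContinuousOn.slice (F := fun t x => deriv (fun s => F s x) t) hF'
      ht).integrableOn_of_closure hB hBU).aestronglyMeasurable
  · exact (ae_restrict_mem hBm).mono fun x hx s hs => hC (s, x) ⟨hs, subset_closure hx⟩
  · exact (ae_restrict_mem hBm).mono fun x hx s hs =>
      (hasDerivAt_of_contDiffOn_prod hI hU hF (hδI hs)
        (hBU (subset_closure hx))).differentiableAt.hasDerivAt

end SpaceTime

section Evolution

variable {n : ℕ} {ι : Type*} [Fintype ι] {U B : Set (Eucl n)} {f : ℝ → ι → Eucl n → ℝ}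
  {φ : Eucl n → ℝ} {κ σ t T : ℝ} {I : Set ℝ} {x : Eucl n}

lemma famGradSq_contDiffOn_prod (hU : IsOpen U) (hI : UniqueDiffOn ℝ I)
    (hf : ∀ i, ContDiffOn ℝ (⊤ : ℕ∞) (fun p : ℝ × Eucl n => f p.1 i p.2) (I ×ˢ U)) :
    ContDiffOn ℝ (⊤ : ℕ∞) (fun p : ℝ × Eucl n => famGradSq (f p.1) p.2) (I ×ˢ U) :=
  ContDiffOn.sum fun a _ => ContDiffOn.sum fun i _ =>
    (pd_contDiffOn_prod (F := fun t => f t i) hU hI (hf i) a).pow 2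

lemma famHessSq_contDiffOn_prod (hU : IsOpen U) (hI : UniqueDiffOn ℝ I)
    (hf : ∀ i, ContDiffOn ℝ (⊤ : ℕ∞) (fun p : ℝ × Eucl n => f p.1 i p.2) (I ×ˢ U)) :
    ContDiffOn ℝ (⊤ : ℕ∞) (fun p : ℝ × Eucl n => famHessSq (f p.1) p.2) (I ×ˢ U) :=
  ContDiffOn.sum fun a _ => ContDiffOn.sum fun b _ => ContDiffOn.sum fun i _ =>
    (pd_contDiffOn_prod (F := fun t => pd b (f t i)) hU hI
      (pd_contDiffOn_prod (F := fun t => f t i) hU hI (hf i) b) a).pow 2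

lemma famWeight_rpow_contDiffOn_prod (hU : IsOpen U) (hI : UniqueDiffOn ℝ I)
    (hf : ∀ i, ContDiffOn ℝ (⊤ : ℕ∞) (fun p : ℝ × Eucl n => f p.1 i p.2) (I ×ˢ U))
    (hκ : 0 < κ) (τ : ℝ) :
    ContDiffOn ℝ (⊤ : ℕ∞) (fun p : ℝ × Eucl n => famWeight (f p.1) κ p.2 ^ τ) (I ×ˢ U) :=
  ((famGradSq_contDiffOn_prod hU hI hf).add contDiffOn_const).rpow_const_of_ne
    fun p _ => (famWeight_pos hκ (f p.1) p.2).ne'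

lemma hasDerivAt_cutoff_weight (hU : IsOpen U) (hI : IsOpen I)
    (hf : ∀ i, ContDiffOn ℝ (⊤ : ℕ∞) (fun p : ℝ × Eucl n => f p.1 i p.2) (I ×ˢ U))
    (hκ : 0 < κ) (ht : t ∈ I) (hx : x ∈ U) :
    HasDerivAt (fun s => φ x ^ 6 * famWeight (f s) κ x ^ (1 + σ))
      (2 * (1 + σ) * ∑ m, ∑ i, φ x ^ 6 * (famWeight (f t) κ x ^ σ * pd m (f t i) x) *
        pd m (fun y => deriv (fun s => f s i y) t) x) t := by
  have hd := fun (m : Fin n) (i : ι) => hasDerivAt_pd (F := fun t => f t i) hI hU (hf i) ht hx m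
  have hv : HasDerivAt (fun s => famWeight (f s) κ x) (∑ m, ∑ i, 2 * (pd m (f t i) x *
      pd m (fun y => deriv (fun s => f s i y) t) x)) t := by
    refine HasDerivAt.add_const κ (HasDerivAt.fun_sum fun m _ => HasDerivAt.fun_sum fun i _ => ?_)
    refine ((hd m i).fun_pow 2).congr_deriv ?_
    simp [mul_assoc]
  refine ((hv.rpow_const (p := 1 + σ)
    (Or.inl (famWeight_pos hκ (f t) x).ne')).const_mul (φ x ^ 6)).congr_deriv ?_
  rw [add_sub_cancel_left]
  simp only [Finset.mul_sum, Finset.sum_mul]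
  refine Finset.sum_congr rfl fun m _ => Finset.sum_congr rfl fun i _ => ?_
  ring

lemma continuousOn_cutoff_dissipation (hU : IsOpen U) (hB : IsCompact (closure B))
    (hBU : closure B ⊆ U) (hBm : MeasurableSet B) (hI : IsCompact I) (hI' : UniqueDiffOn ℝ I)
    (hf : ∀ i, ContDiffOn ℝ (⊤ : ℕ∞) (fun p : ℝ × Eucl n => f p.1 i p.2) (I ×ˢ U))
    (hκ : 0 < κ) (hφ : ContDiff ℝ (⊤ : ℕ∞) φ) (σ : ℝ) :
    ContinuousOn (fun s => ∫ x in B, φ x ^ 6 *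
      (famWeight (f s) κ x ^ σ * (famHessSq (f s) x + famWeight (f s) κ x ^ 2))) I := by
  refine continuousOn_setIntegral (F := fun s x => φ x ^ 6 *
      (famWeight (f s) κ x ^ σ * (famHessSq (f s) x + famWeight (f s) κ x ^ 2)))
    hB hBU hBm hI (ContDiffOn.continuousOn (n := (⊤ : ℕ∞)) (𝕜 := ℝ) ?_)
  exact ((hφ.comp contDiff_snd).pow 6).contDiffOn.mul
    ((famWeight_rpow_contDiffOn_prod hU hI' hf hκ _).mul ((famHessSq_contDiffOn_prod hU hI' hf).add
        (((famGradSq_contDiffOn_prod hU hI' hf).add contDiffOn_const).pow 2)))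

/-- The integrated energy inequality for a smooth family solving a quasilinear heat system that is
a small perturbation of the linear heat equation. -/
theorem evolution_energy_le (hU : IsOpen U) (hB : IsCompact (closure B)) (hBU : closure B ⊆ U)
    (hBm : MeasurableSet B) (hT : 0 < T)
    (hf : ∀ i, ContDiffOn ℝ (⊤ : ℕ∞) (fun p : ℝ × Eucl n => f p.1 i p.2) (Icc 0 T ×ˢ U))
    (hκ : 0 < κ) (hκ1 : κ ≤ 1) (hφ : ContDiff ℝ (⊤ : ℕ∞) φ) (hφB : tsupport φ ⊆ B)
    (hφ0 : ∀ x, 0 ≤ φ x) (hφ1 : ∀ x, φ x ≤ 1) {M : ℝ} (hM0 : 0 ≤ M)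
    (hM : ∀ x k, |pd k φ x| ≤ M) (hσ0 : 0 ≤ σ) (hσ1 : σ ≤ 1 / 4) {ε A : ℝ} (hε1 : ε ≤ 1)
    (hA : 0 ≤ A) (hεb : 4 * (n * Fintype.card ι * A) * ε ≤ 1 / 8)
    (hεN : 4 * ε * (n * Fintype.card ι) * interpCoeff (n * Fintype.card ι * A) ≤ 1 / 4)
    {c : ι → ℝ} (hfc : ∀ s ∈ Ioo 0 T, ∀ x ∈ B, ∀ i, |f s i x + c i| ≤ ε)
    (hDf : ∀ s ∈ Ioo 0 T, ∀ x ∈ B, ∀ i,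
      |deriv (fun s => f s i x) s - ∑ a, pd a (pd a (f s i)) x| ≤
        A * (ε * √(famHessSq (f s) x) + famGradSq (f s) x)) (ht : t ∈ Icc 0 T) :
    (∫ x in B, φ x ^ 6 * famWeight (f t) κ x ^ (1 + σ)) + 1 / 2 * (∫ s in Ioc 0 t, ∫ x in B,
        φ x ^ 6 * (famWeight (f s) κ x ^ σ * (famHessSq (f s) x + famWeight (f s) κ x ^ 2))) ≤
      (∫ x in B, φ x ^ 6 * famWeight (f 0) κ x ^ (1 + σ)) +
        3 * volumeCoeff (cutoffCoeff n (n * Fintype.card ι * A) M) * volume.real B * t := by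
  set V := volumeCoeff (cutoffCoeff n (n * Fintype.card ι * A) M) with hV
  have hV0 : 0 ≤ V := volumeCoeff_nonneg (cutoffCoeff_pos n (n * Fintype.card ι * A) M).le
  have hu := uniqueDiffOn_Icc hT
  have hφ6 : ContDiff ℝ (⊤ : ℕ∞) fun p : ℝ × Eucl n => φ p.2 ^ 6 :=
    (hφ.comp contDiff_snd).pow 6
  have cΦ : ∀ J : Set ℝ, UniqueDiffOn ℝ J → J ⊆ Icc 0 T → ContDiffOn ℝ (⊤ : ℕ∞)
      (fun p : ℝ × Eucl n => φ p.2 ^ 6 * famWeight (f p.1) κ p.2 ^ (1 + σ)) (J ×ˢ U) :=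
    fun J hJ hJT => hφ6.contDiffOn.mul (famWeight_rpow_contDiffOn_prod hU hJ
      (fun i => (hf i).mono (prod_mono hJT subset_rfl)) hκ _)
  set Φ : ℝ → ℝ := fun s => ∫ x in B, φ x ^ 6 * famWeight (f s) κ x ^ (1 + σ) with hΦ
  set Ψ : ℝ → ℝ := fun s => ∫ x in B,
    φ x ^ 6 * (famWeight (f s) κ x ^ σ * (famHessSq (f s) x + famWeight (f s) κ x ^ 2)) with hΨ
  have hΦc : ContinuousOn Φ (Icc 0 T) := continuousOn_setIntegral
    (F := fun s x => φ x ^ 6 * famWeight (f s) κ x ^ (1 + σ)) hB hBU hBm isCompact_Icc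
    (cΦ _ hu subset_rfl).continuousOn
  have hΨc : ContinuousOn Ψ (Icc 0 T) :=
    continuousOn_cutoff_dissipation hU hB hBU hBm isCompact_Icc hu hf hκ hφ σ
  have hsub : Icc 0 t ⊆ Icc 0 T := Icc_subset_Icc_right ht.2
  have hfo : ∀ i, ContDiffOn ℝ (⊤ : ℕ∞) (fun p : ℝ × Eucl n => f p.1 i p.2) (Ioo 0 T ×ˢ U) :=
    fun i => (hf i).mono (prod_mono Ioo_subset_Icc_self subset_rfl)
  have hder : ∀ s ∈ Ioo 0 T, HasDerivAt Φ (∫ x in B, deriv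
      (fun s => φ x ^ 6 * famWeight (f s) κ x ^ (1 + σ)) s) s := fun s hs =>
    hasDerivAt_setIntegral (F := fun s x => φ x ^ 6 * famWeight (f s) κ x ^ (1 + σ)) hU hB hBU hBm
      isOpen_Ioo (cΦ _ isOpen_Ioo.uniqueDiffOn Ioo_subset_Icc_self) hs
  have hbound : ∀ s ∈ Ioo 0 T, (∫ x in B, deriv
      (fun s => φ x ^ 6 * famWeight (f s) κ x ^ (1 + σ)) s) ≤
      -(1 / 2) * Ψ s + 3 * V * volume.real B := by
    intro s hs
    have hst := static_energy_le (f := f s) (D := fun i y => deriv (fun s => f s i y) s) hU hB hBU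
      hBm (fun i => ContDiffOn.slice (F := fun t => f t i) (hfo i) hs)
      (fun i => ContDiffOn.slice (F := fun t y => deriv (fun s => f s i y) t)
        (deriv_contDiffOn_prod (F := fun t => f t i) isOpen_Ioo hU (hfo i)) hs)
      hκ hκ1 hφ hφB hφ0 hφ1 hM0 hM hσ0 hσ1 hε1 hA hεb hεN (hfc s hs) (hDf s hs)
    have hΨ0 : 0 ≤ Ψ s := integral_nonneg fun x => by
      have := famWeight_pos hκ (f s) x
      have := famHessSq_nonneg (f s) x
      have := hφ0 x
      positivity
    have hvol : 0 ≤ V * volume.real B := by positivity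
    rw [setIntegral_congr_fun hBm fun x hx => (hasDerivAt_cutoff_weight (φ := φ) (σ := σ) hU
      isOpen_Ioo hfo hκ hs (hBU (subset_closure hx))).deriv, integral_const_mul]
    calc _ ≤ 2 * (1 + σ) * (-(1 / 4) * Ψ s + V * volume.real B) :=
          mul_le_mul_of_nonneg_left hst (by linarith)
      _ ≤ _ := by nlinarith
  have key := intervalIntegral.sub_le_integral_of_hasDeriv_right_of_le
    (g := Φ) (φ := fun s => -(1 / 2) * Ψ s + 3 * V * volume.real B) ht.1 (hΦc.mono hsub)
    (fun s hs => (hder s ⟨hs.1, hs.2.trans_le ht.2⟩).hasDerivWithinAt)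
    (((hΨc.mono hsub).const_smul (-(1 / 2) : ℝ)).add continuousOn_const |>.integrableOn_Icc)
    (fun s hs => hbound s ⟨hs.1, hs.2.trans_le ht.2⟩)
  have hΨi : IntegrableOn Ψ (Ioc 0 t) :=
    (hΨc.mono hsub).integrableOn_Icc.mono_set Ioc_subset_Icc_self
  rw [intervalIntegral.integral_of_le ht.1, integral_add (hΨi.const_mul _)
    (integrableOn_const measure_Ioc_lt_top.ne), integral_const_mul, setIntegral_const,
    Real.volume_real_Ioc_of_le ht.1, smul_eq_mul] at key
  linarith

end Evolution

section Flow

variable {n : ℕ}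

lemma Matrix.abs_inv_le {G : Matrix (Fin n) (Fin n) ℝ} (hG : IsUnit G.det) {ε : ℝ}
    (hε : n * ε ≤ 1 / 2) (h : ∀ i j, |G i j - (1 : Matrix (Fin n) (Fin n) ℝ) i j| ≤ ε)
    (a b : Fin n) :
    |G⁻¹ a b| ≤ 2 ∧ |G⁻¹ a b - (1 : Matrix (Fin n) (Fin n) ℝ) a b| ≤ 2 * n * ε := by
  have : Nonempty (Fin n × Fin n) := ⟨(a, b)⟩
  have hε0 : 0 ≤ ε := (abs_nonneg _).trans (h a b)
  obtain ⟨⟨a₀, b₀⟩, hmax⟩ := Finite.exists_max fun p : Fin n × Fin n => |G⁻¹ p.1 p.2|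
  set m := |G⁻¹ a₀ b₀|
  have hdiff : ∀ a b, |G⁻¹ a b - (1 : Matrix (Fin n) (Fin n) ℝ) a b| ≤ n * ε * m := by
    intro a b
    have e : G⁻¹ - 1 = -((G - 1) * G⁻¹) := by
      rw [sub_mul, Matrix.mul_nonsing_inv _ hG, one_mul, neg_sub]
    rw [← Matrix.sub_apply, e, Matrix.neg_apply, abs_neg, Matrix.mul_apply]
    calc _ ≤ ∑ k, |(G - 1) a k * G⁻¹ k b| := Finset.abs_sum_le_sum_abs _ _
      _ ≤ ∑ _k : Fin n, ε * m := by
        refine Finset.sum_le_sum fun k _ => ?_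
        rw [abs_mul]
        exact mul_le_mul (h a k) (hmax (k, b)) (abs_nonneg _) hε0
      _ = n * ε * m := by simp [mul_assoc]
  have hm0 : 0 ≤ m := abs_nonneg _
  have hone : |(1 : Matrix (Fin n) (Fin n) ℝ) a₀ b₀| ≤ 1 := by
    rw [Matrix.one_apply]; split_ifs <;> simp
  have hm : m ≤ 2 := by
    have h1 := hdiff a₀ b₀
    have h2 := abs_sub_abs_le_abs_sub (G⁻¹ a₀ b₀) ((1 : Matrix (Fin n) (Fin n) ℝ) a₀ b₀)
    have h3 : n * ε * m ≤ 1 / 2 * m := by gcongr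
    linarith
  refine ⟨(hmax (a, b)).trans hm, (hdiff a b).trans ?_⟩
  have h0 : 0 ≤ n * ε := by positivity
  nlinarith

lemma abs_quasilinear_sub_trace_le {h S : Fin n → Fin n → ℝ}
    {Q : Fin n → Fin n → Fin n → Fin n → ℝ} {ε X Y : ℝ} (hε : 0 ≤ ε)
    (h2 : ∀ a b, |h a b| ≤ 2)
    (h1 : ∀ a b, |h a b - (1 : Matrix (Fin n) (Fin n) ℝ) a b| ≤ 2 * n * ε)
    (hS : ∀ a b, |S a b| ≤ X) (hQ : ∀ a b p q, |Q a b p q| ≤ 9 * Y) :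
    |(∑ a, ∑ b, h a b * S a b) + (1 / 2) * (∑ a, ∑ b, ∑ p, ∑ q, h a b * h p q * Q a b p q)
      - ∑ a, S a a| ≤ 2 * n ^ 3 * (ε * X) + 18 * n ^ 4 * Y := by
  have e1 : ∑ a, S a a = ∑ a, ∑ b, (1 : Matrix (Fin n) (Fin n) ℝ) a b * S a b := by
    simp [Matrix.one_apply]
  have b1 : |∑ a, ∑ b, (h a b - (1 : Matrix (Fin n) (Fin n) ℝ) a b) * S a b| ≤
      2 * n ^ 3 * (ε * X) := by
    calc _ ≤ ∑ _a : Fin n, ∑ _b : Fin n, 2 * n * ε * X :=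
          (Finset.abs_sum_le_sum_abs _ _).trans <| Finset.sum_le_sum fun a _ =>
            (Finset.abs_sum_le_sum_abs _ _).trans <| Finset.sum_le_sum fun b _ => by
              rw [abs_mul]
              exact mul_le_mul (h1 a b) (hS a b) (abs_nonneg _) (by positivity)
      _ = _ := by simp; ring
  have b2 : |∑ a, ∑ b, ∑ p, ∑ q, h a b * h p q * Q a b p q| ≤ 36 * n ^ 4 * Y := by
    calc _ ≤ ∑ _a : Fin n, ∑ _b : Fin n, ∑ _p : Fin n, ∑ _q : Fin n, 2 * 2 * (9 * Y) :=
          (Finset.abs_sum_le_sum_abs _ _).trans <| Finset.sum_le_sum fun a _ =>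
            (Finset.abs_sum_le_sum_abs _ _).trans <| Finset.sum_le_sum fun b _ =>
            (Finset.abs_sum_le_sum_abs _ _).trans <| Finset.sum_le_sum fun p _ =>
            (Finset.abs_sum_le_sum_abs _ _).trans <| Finset.sum_le_sum fun q _ => by
              rw [abs_mul, abs_mul]
              exact mul_le_mul (mul_le_mul (h2 a b) (h2 p q) (abs_nonneg _) (by norm_num))
                (hQ a b p q) (abs_nonneg _) (by norm_num)
      _ = _ := by simp; ring
  simp only [sub_mul, Finset.sum_sub_distrib] at b1
  rw [e1]
  rw [abs_le] at *
  constructor <;> linarith [b1.1, b1.2, b2.1, b2.2]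

/-- The family of components of a matrix field. -/
def components (g : ℝ → Eucl n → Matrix (Fin n) (Fin n) ℝ) (t : ℝ) (i : Fin n × Fin n)
    (x : Eucl n) : ℝ := g t x i.1 i.2

variable {g : ℝ → Eucl n → Matrix (Fin n) (Fin n) ℝ} {I : Set ℝ} {U : Set (Eucl n)} {t : ℝ}
  {x : Eucl n} {ε : ℝ}

lemma gradSq_eq_famGradSq : gradSq g t x = famGradSq (components g t) x := by
  simp only [gradSq, famGradSq, Fintype.sum_prod_type]
  rfl

lemma hessSq_eq_famHessSq : hessSq g t x = famHessSq (components g t) x := by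
  simp only [hessSq, famHessSq, Fintype.sum_prod_type]
  rfl

lemma abs_sub_one_le_of_matDistSq_le {G : Matrix (Fin n) (Fin n) ℝ}
    (h : √(matDistSq G 1) ≤ ε) (i j : Fin n) :
    |G i j - (1 : Matrix (Fin n) (Fin n) ℝ) i j| ≤ ε := by
  refine (Real.abs_le_sqrt ?_).trans h
  calc _ ≤ ∑ j, (G i j - (1 : Matrix (Fin n) (Fin n) ℝ) i j) ^ 2 :=
        Finset.single_le_sum (f := fun j => (G i j - (1 : Matrix (Fin n) (Fin n) ℝ) i j) ^ 2)
          (fun _ _ => sq_nonneg _) (Finset.mem_univ j)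
    _ ≤ _ := Finset.single_le_sum
        (f := fun i => ∑ j, (G i j - (1 : Matrix (Fin n) (Fin n) ℝ) i j) ^ 2)
        (fun _ _ => Finset.sum_nonneg fun _ _ => sq_nonneg _) (Finset.mem_univ i)

/-- A Ricci–DeTurck flow close to the flat metric is a small perturbation of the linear heat flow
up to terms quadratic in the gradient. -/
lemma IsRicciDeTurckFlow.abs_deriv_sub_laplacian_le (hg : IsRicciDeTurckFlow g I U)
    (hε : n * ε ≤ 1 / 2) (ht : t ∈ I) (hx : x ∈ U) (hd : √(matDistSq (g t x) 1) ≤ ε)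
    (i : Fin n × Fin n) :
    |deriv (fun s => components g s i x) t - ∑ a, pd a (pd a (components g t i)) x| ≤
      (2 * n ^ 3 + 18 * n ^ 4) * (ε * √(famHessSq (components g t) x) +
        famGradSq (components g t) x) := by
  obtain ⟨i, j⟩ := i
  have hε0 : 0 ≤ ε := (Real.sqrt_nonneg _).trans hd
  have hdet : IsUnit (g t x).det := (hg.2.1 t ht x hx).2.det_pos.ne'.isUnit
  have hinv := Matrix.abs_inv_le hdet hε (abs_sub_one_le_of_matDistSq_le hd)
  have hu0 := famGradSq_nonneg (components g t) x
  have hS : ∀ a b, |pd a (fun y => pd b (fun z => g t z i j) y) x| ≤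
      √(famHessSq (components g t) x) := fun a b =>
    Real.abs_le_sqrt (sq_pd_pd_le_famHessSq (components g t) x a b (i, j))
  have hP : ∀ a k l, |pd a (fun y => g t y k l) x| ≤ √(famGradSq (components g t) x) :=
    fun a k l => Real.abs_le_sqrt (sq_pd_le_famGradSq (components g t) x a (k, l))
  have hPP : ∀ a k l b k' l', |pd a (fun y => g t y k l) x * pd b (fun y => g t y k' l') x| ≤
      famGradSq (components g t) x := by
    intro a k l b k' l'
    rw [abs_mul]
    exact (mul_le_mul (hP a k l) (hP b k' l') (abs_nonneg _) (Real.sqrt_nonneg _)).trans_eq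
      (Real.mul_self_sqrt hu0)
  have main := abs_quasilinear_sub_trace_le (Y := famGradSq (components g t) x) hε0
    (fun a b => (hinv a b).1)
    (fun a b => (hinv a b).2) hS (Q := fun a b p q =>
        pd i (fun y => g t y p a) x * pd j (fun y => g t y q b) x
          + 2 * pd a (fun y => g t y j p) x * pd q (fun y => g t y i b) x
          - 2 * pd a (fun y => g t y j p) x * pd b (fun y => g t y i q) x
          - 2 * pd j (fun y => g t y p a) x * pd b (fun y => g t y i q) x
          - 2 * pd i (fun y => g t y p a) x * pd b (fun y => g t y j q) x) (fun a b p q => by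
      have h1 := abs_le.1 (hPP i p a j q b)
      have h2 := abs_le.1 (hPP a j p q i b)
      have h3 := abs_le.1 (hPP a j p b i q)
      have h4 := abs_le.1 (hPP j p a b i q)
      have h5 := abs_le.1 (hPP i p a b j q)
      rw [abs_le]
      constructor <;> linarith [h1.1, h1.2, h2.1, h2.2, h3.1, h3.2, h4.1, h4.2, h5.1, h5.2])
  rw [← hg.2.2 t ht x hx i j] at main
  refine main.trans ?_
  have hX : 0 ≤ ε * √(famHessSq (components g t) x) := by positivity
  have hn3 : (0 : ℝ) ≤ n ^ 3 := by positivity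
  have hn4 : (0 : ℝ) ≤ n ^ 4 := by positivity
  nlinarith [mul_nonneg hn3 hu0, mul_nonneg hn4 hX]

end Flow

section Cutoff

variable {n : ℕ}

lemma exists_cutoff (n : ℕ) {r ℓ : ℝ} (hr : 0 < r) (hrℓ : r < ℓ) :
    ∃ M : ℝ, 0 ≤ M ∧ ∀ y₀ : Eucl n, ∃ φ : Eucl n → ℝ, ContDiff ℝ (⊤ : ℕ∞) φ ∧
      tsupport φ ⊆ ball y₀ ℓ ∧ (∀ x, 0 ≤ φ x) ∧ (∀ x, φ x ≤ 1) ∧ (∀ x ∈ ball y₀ r, φ x = 1) ∧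
      ∀ x k, |pd k φ x| ≤ M := by
  let χ : ContDiffBump (0 : Eucl n) := ⟨r, (r + ℓ) / 2, hr, by linarith⟩
  have hχ : ContDiff ℝ (⊤ : ℕ∞) χ := χ.contDiff
  obtain ⟨M, hM⟩ := (χ.hasCompactSupport.fderiv (𝕜 := ℝ)).exists_bound_of_continuous
    (hχ.continuous_fderiv (by simp))
  refine ⟨M, (norm_nonneg _).trans (hM 0), fun y₀ => ⟨fun x => χ (x - y₀),
    hχ.comp (contDiff_id.sub contDiff_const), ?_, fun _ => χ.nonneg, fun _ => χ.le_one,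
    fun x hx => χ.one_of_mem_closedBall ?_, fun x k => ?_⟩⟩
  · have hsub : Function.support (fun x => χ (x - y₀)) ⊆ closedBall y₀ ((r + ℓ) / 2) := by
      intro x hx
      have : x - y₀ ∈ Function.support χ := hx
      rw [χ.support_eq, mem_ball_zero_iff] at this
      rw [mem_closedBall, dist_eq_norm]
      exact this.le
    exact (closure_minimal hsub isClosed_closedBall).trans (closedBall_subset_ball (by linarith))
  · rw [mem_closedBall_zero_iff, ← dist_eq_norm]
    exact (mem_ball.1 hx).le
  · simp only [pd]
    rw [fderiv_comp_sub, ← Real.norm_eq_abs]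
    refine ((fderiv ℝ χ (x - y₀)).le_opNorm _).trans ?_
    simpa using hM (x - y₀)

end Cutoff

section LocalEstimate

lemma add_rpow_le {u κ σ : ℝ} (hu : 0 ≤ u) (hκ : 0 < κ) (hκ1 : κ ≤ 1) (hσ0 : 0 ≤ σ)
    (hσ1 : σ ≤ 1) : (u + κ) ^ (1 + σ) ≤ 4 * u ^ (1 + σ) + 4 * κ := by
  have h2 : (2 : ℝ) ^ (1 + σ) ≤ 4 :=
    (Real.rpow_le_rpow_of_exponent_le one_le_two (by linarith : 1 + σ ≤ 2)).trans (by norm_num)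
  have hdouble : ∀ y : ℝ, 0 ≤ y → (2 * y) ^ (1 + σ) ≤ 4 * y ^ (1 + σ) := fun y hy => by
    rw [Real.mul_rpow zero_le_two hy]
    gcongr
  rcases le_total u κ with h | h
  · have hκ' : κ ^ (1 + σ) ≤ κ := by
      simpa using Real.rpow_le_rpow_of_exponent_ge hκ hκ1 (by linarith : 1 ≤ 1 + σ)
    have := Real.rpow_nonneg hu (1 + σ)
    calc (u + κ) ^ (1 + σ) ≤ (2 * κ) ^ (1 + σ) :=
          Real.rpow_le_rpow (by positivity) (by linarith) (by linarith)
      _ ≤ 4 * κ ^ (1 + σ) := hdouble κ hκ.le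
      _ ≤ _ := by linarith
  · calc (u + κ) ^ (1 + σ) ≤ (2 * u) ^ (1 + σ) :=
          Real.rpow_le_rpow (by positivity) (by linarith) (by linarith)
      _ ≤ 4 * u ^ (1 + σ) := hdouble u hu
      _ ≤ _ := by linarith

lemma setIntegral_le_of_subset {α : Type*} [MeasurableSpace α] {μ : Measure α} {s t : Set α}
    {p q : α → ℝ} (hs : MeasurableSet s) (hst : s ⊆ t) (hq : IntegrableOn q t μ)
    (hp0 : ∀ x, 0 ≤ p x) (hq0 : ∀ x, 0 ≤ q x) (hpq : ∀ x ∈ s, p x ≤ q x) :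
    ∫ x in s, p x ∂μ ≤ ∫ x in t, q x ∂μ :=
  (integral_mono_of_nonneg (ae_of_all _ hp0) (hq.mono_set hst)
    ((ae_restrict_mem hs).mono hpq)).trans
    (setIntegral_mono_set hq (ae_of_all _ hq0) hst.eventuallyLE)

variable {n : ℕ} {ι : Type*} [Fintype ι] {U B B' : Set (Eucl n)} {f : ℝ → ι → Eucl n → ℝ}
  {φ : Eucl n → ℝ} {σ t T : ℝ}

/-- The local higher-integrability estimate for a smooth family solving a quasilinear heat system
that is a small perturbation of the linear heat equation. -/
theorem local_gradient_estimate (hU : IsOpen U) (hB : IsCompact (closure B)) (hBU : closure B ⊆ U)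
    (hBm : MeasurableSet B) (hB' : MeasurableSet B') (hB'B : B' ⊆ B) (hT : 0 < T) (hT1 : T ≤ 1)
    (hf : ∀ i, ContDiffOn ℝ (⊤ : ℕ∞) (fun p : ℝ × Eucl n => f p.1 i p.2) (Icc 0 T ×ˢ U))
    (hφ : ContDiff ℝ (⊤ : ℕ∞) φ) (hφB : tsupport φ ⊆ B)
    (hφ0 : ∀ x, 0 ≤ φ x) (hφ1 : ∀ x, φ x ≤ 1) (hφB' : ∀ x ∈ B', φ x = 1) {M : ℝ} (hM0 : 0 ≤ M)
    (hM : ∀ x k, |pd k φ x| ≤ M) (hσ0 : 0 ≤ σ) (hσ1 : σ ≤ 1 / 4) {ε A : ℝ} (hε1 : ε ≤ 1)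
    (hA : 0 ≤ A) (hεb : 4 * (n * Fintype.card ι * A) * ε ≤ 1 / 8)
    (hεN : 4 * ε * (n * Fintype.card ι) * interpCoeff (n * Fintype.card ι * A) ≤ 1 / 4)
    {c : ι → ℝ} (hfc : ∀ s ∈ Ioo 0 T, ∀ x ∈ B, ∀ i, |f s i x + c i| ≤ ε)
    (hDf : ∀ s ∈ Ioo 0 T, ∀ x ∈ B, ∀ i,
      |deriv (fun s => f s i x) s - ∑ a, pd a (pd a (f s i)) x| ≤
        A * (ε * √(famHessSq (f s) x) + famGradSq (f s) x)) (ht : t ∈ Icc 0 T) :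
    (∫ x in B', famGradSq (f t) x ^ (1 + σ)) + (∫ s in Ioc 0 t, ∫ x in B',
        (famGradSq (f s) x ^ (2 + σ) + famGradSq (f s) x ^ σ * famHessSq (f s) x)) ≤
      8 * (∫ x in B, famGradSq (f 0) x ^ (1 + σ)) +
        (8 + 6 * volumeCoeff (cutoffCoeff n (n * Fintype.card ι * A) M)) * volume.real B * t := by
  have hu := uniqueDiffOn_Icc hT
  have h0T : (0 : ℝ) ∈ Icc 0 T := left_mem_Icc.2 hT.le
  have hfs : ∀ s ∈ Icc 0 T, ∀ i, ContDiffOn ℝ (⊤ : ℕ∞) (f s i) U := fun s hs i =>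
    ContDiffOn.slice (F := fun t => f t i) (hf i) hs
  have hgi : IntegrableOn (fun x => famGradSq (f 0) x ^ (1 + σ)) B :=
    ((famGradSq_contDiffOn hU (hfs 0 h0T)).continuousOn.rpow_const fun _ _ =>
      Or.inr (by linarith)).integrableOn_of_closure hB hBU
  have hg0 : ∀ (s τ : ℝ) (x : Eucl n), 0 ≤ famGradSq (f s) x ^ τ := fun s τ x =>
    Real.rpow_nonneg (famGradSq_nonneg _ _) _
  obtain ht0 | ht0 := ht.1.eq_or_lt
  · subst ht0
    have h1 := setIntegral_le_of_subset hB' hB'B hgi (hg0 0 _) (hg0 0 _) fun _ _ => le_rfl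
    have h2 : 0 ≤ ∫ x in B, famGradSq (f 0) x ^ (1 + σ) := integral_nonneg (hg0 0 _)
    simp only [Ioc_self, Measure.restrict_empty, integral_zero_measure, mul_zero, add_zero]
    linarith
  have ht1 : t ≤ 1 := ht.2.trans hT1
  have hBfin : volume B ≠ ⊤ := ((measure_mono subset_closure).trans_lt hB.measure_lt_top).ne
  have hv : ∀ s x, 0 < famWeight (f s) t x := fun s x => famWeight_pos ht0 (f s) x
  have huv : ∀ s x, famGradSq (f s) x ≤ famWeight (f s) t x := fun s x => by
    simp [famWeight, ht0.le]
  have hH : ∀ s x, 0 ≤ famHessSq (f s) x := fun s x => famHessSq_nonneg (f s) x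
  have hE : ∀ s ∈ Icc 0 T, IntegrableOn (fun x => φ x ^ 6 * famWeight (f s) t x ^ (1 + σ)) B :=
    fun s hs => ((hφ.pow 6).contDiffOn.mul
      (famWeight_rpow_contDiffOn hU (hfs s hs) ht0 _)).continuousOn.integrableOn_of_closure hB hBU
  have hE0 : ∀ s x, 0 ≤ φ x ^ 6 * famWeight (f s) t x ^ (1 + σ) := fun s x =>
    mul_nonneg (pow_nonneg (hφ0 x) _) (Real.rpow_nonneg (hv s x).le _)
  have hΨ0 : ∀ s x, 0 ≤ φ x ^ 6 *
      (famWeight (f s) t x ^ σ * (famHessSq (f s) x + famWeight (f s) t x ^ 2)) := fun s x =>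
    mul_nonneg (pow_nonneg (hφ0 x) _) (mul_nonneg (Real.rpow_nonneg (hv s x).le _)
      (add_nonneg (hH s x) (sq_nonneg _)))
  have hend : (∫ x in B', famGradSq (f t) x ^ (1 + σ)) ≤
      ∫ x in B, φ x ^ 6 * famWeight (f t) t x ^ (1 + σ) :=
    setIntegral_le_of_subset hB' hB'B (hE t ht) (hg0 t _) (hE0 t) fun x hx => by
      rw [hφB' x hx, one_pow, one_mul]
      exact Real.rpow_le_rpow (famGradSq_nonneg _ _) (huv t x) (by linarith)
  have hp0 : ∀ s x, 0 ≤ famGradSq (f s) x ^ (2 + σ) + famGradSq (f s) x ^ σ * famHessSq (f s) x :=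
    fun s x => add_nonneg (hg0 s _ x) (mul_nonneg (hg0 s _ x) (hH s x))
  have hdiss : (∫ s in Ioc 0 t, ∫ x in B',
        (famGradSq (f s) x ^ (2 + σ) + famGradSq (f s) x ^ σ * famHessSq (f s) x)) ≤
      ∫ s in Ioc 0 t, ∫ x in B, φ x ^ 6 *
        (famWeight (f s) t x ^ σ * (famHessSq (f s) x + famWeight (f s) t x ^ 2)) := by
    refine setIntegral_le_of_subset measurableSet_Ioc subset_rfl ?_
      (fun s => integral_nonneg (hp0 s)) (fun s => integral_nonneg (hΨ0 s)) fun s hs => ?_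
    · exact ((continuousOn_cutoff_dissipation hU hB hBU hBm isCompact_Icc hu hf ht0 hφ σ).mono
        (Icc_subset_Icc_right ht.2)).integrableOn_Icc.mono_set Ioc_subset_Icc_self
    have hs' : s ∈ Icc 0 T := ⟨hs.1.le, hs.2.trans ht.2⟩
    refine setIntegral_le_of_subset hB' hB'B ?_ (hp0 s) (hΨ0 s) fun x hx => ?_
    · exact ((hφ.pow 6).contDiffOn.mul ((famWeight_rpow_contDiffOn hU (hfs s hs') ht0 σ).mul
        ((famHessSq_contDiffOn hU (hfs s hs')).add
        (((famGradSq_contDiffOn hU (hfs s hs')).add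
          contDiffOn_const).pow 2)))).continuousOn.integrableOn_of_closure hB hBU
    · rw [hφB' x hx, one_pow, one_mul, mul_add, add_comm]
      have hσv := Real.rpow_le_rpow (famGradSq_nonneg _ _) (huv s x) hσ0
      refine add_le_add (mul_le_mul_of_nonneg_right hσv (hH s x)) ?_
      rw [← Real.rpow_natCast, ← Real.rpow_add (hv s x), Nat.cast_ofNat, add_comm σ]
      exact Real.rpow_le_rpow (famGradSq_nonneg _ _) (huv s x) (by linarith)
  have hstart : (∫ x in B, φ x ^ 6 * famWeight (f 0) t x ^ (1 + σ)) ≤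
      4 * (∫ x in B, famGradSq (f 0) x ^ (1 + σ)) + 4 * t * volume.real B := by
    calc _ ≤ ∫ x in B, (4 * famGradSq (f 0) x ^ (1 + σ) + 4 * t) :=
          setIntegral_mono_on (hE 0 h0T) ((hgi.const_mul 4).add (integrableOn_const hBfin)) hBm
            fun x _ => (mul_le_of_le_one_left (Real.rpow_nonneg (hv 0 x).le _)
              (pow_le_one₀ (hφ0 x) (hφ1 x))).trans
              (add_rpow_le (famGradSq_nonneg _ _) ht0 ht1 hσ0 (by linarith))
      _ = _ := by
          rw [integral_add (hgi.const_mul 4) (integrableOn_const hBfin), integral_const_mul,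
            setIntegral_const, smul_eq_mul, mul_comm (volume.real B)]
  have hevol := evolution_energy_le hU hB hBU hBm hT hf ht0 ht1 hφ hφB hφ0 hφ1 hM0 hM hσ0 hσ1
    hε1 hA hεb hεN hfc hDf ht
  have hend0 : 0 ≤ ∫ x in B, φ x ^ 6 * famWeight (f t) t x ^ (1 + σ) := integral_nonneg (hE0 t)
  linarith

end LocalEstimate

lemma exists_smallness {m b N Λ : ℝ} (hm : 0 ≤ m) (hb : 0 ≤ b) (hN : 0 ≤ N) (hΛ : 0 ≤ Λ) :
    ∃ ε : ℝ, 0 < ε ∧ ε ≤ 1 ∧ m * ε ≤ 1 / 2 ∧ 4 * b * ε ≤ 1 / 8 ∧ 4 * ε * N * Λ ≤ 1 / 4 := by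
  have hNΛ := mul_nonneg hN hΛ
  set d := 1 + 2 * m + 32 * b + 16 * (N * Λ)
  have hd : 0 < d := by positivity
  refine ⟨1 / d, by positivity, ?_, ?_, ?_, ?_⟩
  · rw [div_le_one hd]; linarith
  · rw [mul_one_div, div_le_iff₀ hd]; linarith
  · rw [mul_one_div, div_le_iff₀ hd]; linarith
  · rw [show 4 * (1 / d) * N * Λ = 4 * (N * Λ) / d by ring, div_le_iff₀ hd]; linarith

/-- `W^{1,2+2σ}` a priori estimate for the Ricci–DeTurck flow with flat
background, `σ ∈ [0, 1/4]`.  Here `|∂g|^{2+2σ} = (|∂g|²)^{1+σ}`,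
`|∂g|^{4+2σ} = (|∂g|²)^{2+σ}` and `|∂g|^{2σ}|∂²g|² = (|∂g|²)^σ |∂²g|²`. -/
theorem W12sigma_apriori_estimate (n : ℕ) (hn : 1 ≤ n) :
    ∃ ε₀ : ℝ, 0 < ε₀ ∧ ∃ c₁ : ℝ, 0 < c₁ ∧
      ∀ r ℓ : ℝ, 0 < r → r < ℓ →
        ∃ c₂ : ℝ, 0 < c₂ ∧
          ∀ σ : ℝ, σ ∈ Set.Icc (0 : ℝ) (1/4) →
          ∀ (y₀ : Eucl n) (T : ℝ), T ∈ Set.Ioc (0 : ℝ) 1 →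
          ∀ g : ℝ → Eucl n → Matrix (Fin n) (Fin n) ℝ,
            IsRicciDeTurckFlow g (Set.Icc 0 T) (ball y₀ (4 * ℓ)) →
            (∀ t ∈ Set.Icc (0 : ℝ) T, ∀ x ∈ ball y₀ (4 * ℓ),
              Real.sqrt (matDistSq (g t x) 1) ≤ ε₀) →
            ∀ t ∈ Set.Icc (0 : ℝ) T,
              (∫ x in ball y₀ r, (gradSq g t x) ^ (1 + σ))
                  + (∫ s in Set.Ioc (0 : ℝ) t, ∫ x in ball y₀ r,
                      ((gradSq g s x) ^ (2 + σ) + (gradSq g s x) ^ σ * hessSq g s x))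
                ≤ c₁ * (∫ x in ball y₀ ℓ, (gradSq g 0 x) ^ (1 + σ))
                  + c₂ * t * (1 + ∫ x in ball y₀ ℓ, gradSq g 0 x) := by
  set A : ℝ := 2 * n ^ 3 + 18 * n ^ 4 with hA
  set N : ℝ := n * Fintype.card (Fin n × Fin n) with hN
  have hA0 : 0 ≤ A := by positivity
  obtain ⟨ε, hε0, hε1, hεn, hεb, hεN⟩ := exists_smallness (m := n) (b := N * A) (N := N)
    (Λ := interpCoeff (N * A)) (by positivity) (by positivity) (by positivity)
    (interpCoeff_pos _).le
  refine ⟨ε, hε0, 8, by norm_num, fun r ℓ hr hrℓ => ?_⟩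
  obtain ⟨M, hM0, hcut⟩ := exists_cutoff n hr hrℓ
  set C := (8 + 6 * volumeCoeff (cutoffCoeff n (N * A) M)) * volume.real (ball (0 : Eucl n) ℓ)
    with hC
  have hV0 := volumeCoeff_nonneg (cutoffCoeff_pos n (N * A) M).le
  have hC0 : 0 ≤ C := by positivity
  refine ⟨C + 1, by positivity, fun σ hσ y₀ T hT g hg hd t ht => ?_⟩
  obtain ⟨φ, hφ, hφB, hφ0, hφ1, hφr, hφM⟩ := hcut y₀
  have hℓ : 0 < ℓ := hr.trans hrℓ
  have hcl : closure (ball y₀ ℓ) ⊆ closedBall y₀ ℓ := closure_ball_subset_closedBall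
  have hclU : closure (ball y₀ ℓ) ⊆ ball y₀ (4 * ℓ) :=
    hcl.trans (closedBall_subset_ball (by linarith))
  have hBU : ball y₀ ℓ ⊆ ball y₀ (4 * ℓ) := subset_closure.trans hclU
  have key := local_gradient_estimate (f := components g)
    (c := fun i => -(1 : Matrix (Fin n) (Fin n) ℝ) i.1 i.2) isOpen_ball
    ((isCompact_closedBall y₀ ℓ).of_isClosed_subset isClosed_closure hcl) hclU measurableSet_ball
    measurableSet_ball (ball_subset_ball hrℓ.le) hT.1 hT.2 (fun i => hg.1 i.1 i.2) hφ hφB hφ0 hφ1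
    hφr hM0 hφM hσ.1 hσ.2 hε1 hA0 hεb hεN
    (fun s hs x hx i => abs_sub_one_le_of_matDistSq_le
      (hd s (Ioo_subset_Icc_self hs) x (hBU hx)) i.1 i.2)
    (fun s hs x hx i => hg.abs_deriv_sub_laplacian_le hεn (Ioo_subset_Icc_self hs) (hBU hx)
      (hd s (Ioo_subset_Icc_self hs) x (hBU hx)) i) ht
  rw [Measure.addHaar_real_ball_center volume y₀ ℓ] at key
  simp only [gradSq_eq_famGradSq, hessSq_eq_famHessSq]
  refine key.trans ?_
  rw [← hN, ← hC]
  have hI : 0 ≤ ∫ x in ball y₀ ℓ, famGradSq (components g 0) x :=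
    integral_nonneg fun x => famGradSq_nonneg _ x
  have ht0 := ht.1
  refine add_le_add le_rfl ?_
  nlinarith [mul_nonneg ht0 (mul_nonneg hC0 hI), mul_nonneg ht0 hI, mul_nonneg ht0 hC0]
end
end
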